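/- Let p, q be positive integers and n = p+q. Let Ω be the 2n×2n block matrix [[0, I_n], [-I_n, 0]], let G = {A ∈ GL(2n, ℂ) : Aᵀ Ω A = Ω} (the complex symplectic group Sp(2n, ℂ)), let K = diag(I_p, -I_q, I_p, -I_q), and let H = {A ∈ G : A* K A = K} (the standard realization of the quaternionic unitary group Sp(p,q) inside Sp(2n,ℂ)). Then there is no discrete subgroup Γ of G acting properly discontinuously and cocompactly on the homogeneous space G/H; that is, Sp(2(p+q),ℂ)/Sp(p,q) admits no compact Clifford–Klein form. -/

import Mathlib

/-!
The homogeneous space `Sp(2(p+q),ℂ)/Sp(p,q)` admits no compact Clifford–Klein form.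
-/

open Matrix

set_option maxHeartbeats 1000000
set_option synthInstance.maxHeartbeats 1000000

noncomputable section

/-- The index type for `2n × 2n` block matrices with `n = p + q`. -/
abbrev SpIdx (p q : ℕ) := (Fin p ⊕ Fin q) ⊕ (Fin p ⊕ Fin q)

/-- The standard symplectic matrix `Ω = [[0, I_n], [-I_n, 0]]`, `n = p + q`. -/
def OmegaC (p q : ℕ) : Matrix (SpIdx p q) (SpIdx p q) ℂ :=
  Matrix.fromBlocks 0 1 (-1) 0

/-- The complex symplectic group `Sp(2n, ℂ)` (`n = p + q`), realized as the subgroup of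
`GL(2n, ℂ)` of matrices `A` with `Aᵀ Ω A = Ω`. -/
def SpC (p q : ℕ) : Subgroup (GL (SpIdx p q) ℂ) where
  carrier := {A | A.valᵀ * OmegaC p q * A.val = OmegaC p q}
  one_mem' := by simp
  mul_mem' := by
    intro A B hA hB
    show (A * B).valᵀ * OmegaC p q * (A * B).val = OmegaC p q
    have key : (A * B).valᵀ * OmegaC p q * (A * B).val =
        B.valᵀ * (A.valᵀ * OmegaC p q * A.val) * B.val := by
      rw [Units.val_mul, transpose_mul]
      simp only [Matrix.mul_assoc]
    rw [key, hA]
    exact hB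
  inv_mem' := by
    intro A hA
    show (A⁻¹).valᵀ * OmegaC p q * (A⁻¹).val = OmegaC p q
    calc (A⁻¹).valᵀ * OmegaC p q * (A⁻¹).val
        = (A⁻¹).valᵀ * (A.valᵀ * OmegaC p q * A.val) * (A⁻¹).val := by rw [hA]
      _ = (A.val * (A⁻¹).val)ᵀ * OmegaC p q * (A.val * (A⁻¹).val) := by
          rw [transpose_mul]
          simp only [Matrix.mul_assoc]
      _ = OmegaC p q := by rw [Units.mul_inv]; simp

/-- The signature matrix `K = diag(I_p, -I_q, I_p, -I_q)`. -/
def Kpq (p q : ℕ) : Matrix (SpIdx p q) (SpIdx p q) ℂ :=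
  Matrix.diagonal (Sum.elim (Sum.elim (fun _ => 1) (fun _ => -1))
    (Sum.elim (fun _ => 1) (fun _ => -1)))

/-- The quaternionic unitary group `Sp(p,q)`, realized as the subgroup of `Sp(2(p+q),ℂ)`
of matrices `A` with `A* K A = K`, where `A*` is the conjugate transpose and
`K = diag(I_p, -I_q, I_p, -I_q)`. -/
def SpPQ (p q : ℕ) : Subgroup ↥(SpC p q) where
  carrier := {A | A.val.valᴴ * Kpq p q * A.val.val = Kpq p q}
  one_mem' := by
    show (1 : Matrix (SpIdx p q) (SpIdx p q) ℂ)ᴴ * Kpq p q * 1 = Kpq p q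
    simp
  mul_mem' := by
    intro A B hA hB
    show (A * B).val.valᴴ * Kpq p q * (A * B).val.val = Kpq p q
    have h : (A * B).val.val = A.val.val * B.val.val := rfl
    have key : (A.val.val * B.val.val)ᴴ * Kpq p q * (A.val.val * B.val.val) =
        B.val.valᴴ * (A.val.valᴴ * Kpq p q * A.val.val) * B.val.val := by
      rw [conjTranspose_mul]
      simp only [Matrix.mul_assoc]
    rw [h, key, hA]
    exact hB
  inv_mem' := by
    intro A hA
    show (A⁻¹).val.valᴴ * Kpq p q * (A⁻¹).val.val = Kpq p q
    have hAinv : A.val.val * (A⁻¹).val.val = 1 := by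
      have h : (A⁻¹).val = (A.val)⁻¹ := rfl
      rw [h]; exact Units.mul_inv A.val
    calc (A⁻¹).val.valᴴ * Kpq p q * (A⁻¹).val.val
        = (A⁻¹).val.valᴴ * (A.val.valᴴ * Kpq p q * A.val.val) * (A⁻¹).val.val := by rw [hA]
      _ = (A.val.val * (A⁻¹).val.val)ᴴ * Kpq p q * (A.val.val * (A⁻¹).val.val) := by
          rw [conjTranspose_mul]
          simp only [Matrix.mul_assoc]
      _ = Kpq p q := by rw [hAinv]; simp

section Degree

open MeasureTheory Topology

lemma indicator_eventuallyEq_zero {X : Type*} [TopologicalSpace X] {U : Set X} {f : X → ℝ}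
    (h : ∀ x ∈ frontier U, f =ᶠ[𝓝 x] 0) {x : X} (hx : x ∉ interior U) :
    U.indicator f =ᶠ[𝓝 x] 0 := by
  by_cases hc : x ∈ closure U
  · filter_upwards [h x ⟨hc, hx⟩] with y hy
    by_cases hyU : y ∈ U <;> simp [hyU, hy]
  · filter_upwards [isClosed_closure.isOpen_compl.mem_nhds hc] with y hy
    exact Set.indicator_of_notMem (fun h' => hy (subset_closure h')) _

lemma indicator_eventuallyEq_self {X : Type*} [TopologicalSpace X] {U : Set X} {f : X → ℝ}
    {x : X} (hx : x ∈ interior U) : U.indicator f =ᶠ[𝓝 x] f := by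
  filter_upwards [mem_interior_iff_mem_nhds.mp hx] with y hy
  exact Set.indicator_of_mem hy _

lemma contDiff_indicator {n : WithTop ℕ∞} {E : Type*} [NormedAddCommGroup E]
    [NormedSpace ℝ E] {U : Set E} {f : E → ℝ}
    (hf : ContDiff ℝ n f) (h : ∀ x ∈ frontier U, f =ᶠ[𝓝 x] 0) :
    ContDiff ℝ n (U.indicator f) := by
  rw [contDiff_iff_contDiffAt]
  intro x
  by_cases hx : x ∈ interior U
  · exact hf.contDiffAt.congr_of_eventuallyEq (indicator_eventuallyEq_self hx)
  · exact contDiffAt_const.congr_of_eventuallyEq (indicator_eventuallyEq_zero h hx)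

variable {ι : Type*} [Fintype ι] [DecidableEq ι]

/-- The `j`-th partial derivative of a function on `ι → ℝ`. -/
noncomputable def partialDeriv (j : ι) (u : (ι → ℝ) → ℝ) (x : ι → ℝ) : ℝ :=
  fderiv ℝ u x (Pi.single j 1)

/-- The Jacobian determinant of a family of functions. -/
noncomputable def jacobianDet (u : ι → (ι → ℝ) → ℝ) (x : ι → ℝ) : ℝ :=
  (Matrix.of fun j i => partialDeriv j (u i) x).det

lemma contDiff_partialDeriv {n : ℕ} {u : (ι → ℝ) → ℝ} (hu : ContDiff ℝ (n + 1) u) (j : ι) :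
    ContDiff ℝ n (partialDeriv j u) := by
  unfold partialDeriv
  exact (hu.fderiv_right (m := n) (by norm_cast)).clm_apply contDiff_const

lemma partialDeriv_comm {u : (ι → ℝ) → ℝ} (hu : ContDiff ℝ 2 u) (j k : ι) (x : ι → ℝ) :
    partialDeriv j (partialDeriv k u) x = partialDeriv k (partialDeriv j u) x := by
  have hd : DifferentiableAt ℝ (fderiv ℝ u) x :=
    ((hu.fderiv_right (m := 1) (by norm_num)).differentiable (by norm_num)) x
  have h : ∀ a b : ι, partialDeriv a (partialDeriv b u) x =
      fderiv ℝ (fderiv ℝ u) x (Pi.single a 1) (Pi.single b 1) := by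
    intro a b
    unfold partialDeriv
    rw [fderiv_clm_apply hd (differentiableAt_const _)]
    simp
  rw [h, h]
  exact (hu.contDiffAt.isSymmSndFDerivAt (by simp)) _ _

lemma partialDeriv_prod {s : Finset ι} {f : ι → (ι → ℝ) → ℝ} (hf : ∀ i, ContDiff ℝ 1 (f i))
    (j : ι) (x : ι → ℝ) :
    partialDeriv j (fun y => ∏ i ∈ s, f i y) x =
      ∑ l ∈ s, (∏ i ∈ s.erase l, f i x) * partialDeriv j (f l) x := by
  unfold partialDeriv
  rw [fderiv_finsetProd (fun i _ => ((hf i).differentiable (by norm_num)) x)]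
  simp

/-- The divergence-free property of cofactors of a Jacobian matrix. -/
lemma sum_sign_mul_partialDeriv_cofactor {u : ι → (ι → ℝ) → ℝ} (hu : ∀ i, ContDiff ℝ 2 (u i))
    (k : ι) (x : ι → ℝ) :
    ∑ σ : Equiv.Perm ι, ((Equiv.Perm.sign σ : ℤ) : ℝ) *
      partialDeriv (σ k) (fun y => ∏ i ∈ Finset.univ.erase k, partialDeriv (σ i) (u i) y) x =
        0 := by
  have h1 : ∀ i j, ContDiff ℝ 1 (partialDeriv j (u i)) := fun i j =>
    contDiff_partialDeriv (n := 1) (by exact_mod_cast hu i) j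
  simp_rw [partialDeriv_prod (fun i => h1 i _), Finset.mul_sum]
  rw [Finset.sum_comm]
  refine Finset.sum_eq_zero fun l hl => ?_
  have hlk : l ≠ k := (Finset.mem_erase.mp hl).1
  refine Finset.sum_involution (fun σ _ => σ * Equiv.swap k l) ?_ ?_ ?_ ?_
  · intro σ _
    have hs : ((Equiv.Perm.sign (σ * Equiv.swap k l) : ℤ) : ℝ) =
        -((Equiv.Perm.sign σ : ℤ) : ℝ) := by
      rw [Equiv.Perm.sign_mul, Equiv.Perm.sign_swap hlk.symm]; simp
    have hp : ∏ i ∈ (Finset.univ.erase k).erase l, partialDeriv ((σ * Equiv.swap k l) i) (u i) x =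
        ∏ i ∈ (Finset.univ.erase k).erase l, partialDeriv (σ i) (u i) x := by
      refine Finset.prod_congr rfl fun i hi => ?_
      simp only [Finset.mem_erase] at hi
      rw [Equiv.Perm.mul_apply, Equiv.swap_apply_of_ne_of_ne hi.2.1 hi.1]
    rw [hs, hp]
    simp only [Equiv.Perm.mul_apply, Equiv.swap_apply_left, Equiv.swap_apply_right]
    rw [partialDeriv_comm (hu l) (σ l) (σ k)]
    ring
  · intro σ _ _ h
    have : Equiv.swap k l = 1 := by simpa using h
    exact hlk ((Equiv.swap_eq_one_iff).mp this).symm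
  · simp
  · intro σ _
    simp [mul_assoc]

lemma integral_jacobianDet_eq_zero {u : ι → (ι → ℝ) → ℝ} (hu : ∀ i, ContDiff ℝ 2 (u i))
    {k : ι} (hk : HasCompactSupport (u k)) : ∫ x, jacobianDet u x = 0 := by
  have h1 : ∀ i j, ContDiff ℝ 1 (partialDeriv j (u i)) := fun i j =>
    contDiff_partialDeriv (n := 1) (by exact_mod_cast hu i) j
  have hP : ∀ σ : Equiv.Perm ι, ContDiff ℝ 1
      (fun y => ∏ i ∈ Finset.univ.erase k, partialDeriv (σ i) (u i) y) :=
    fun σ => contDiff_prod fun i _ => h1 i _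
  have hk' : ∀ j, HasCompactSupport (partialDeriv j (u k)) := fun j =>
    hk.fderiv_apply (𝕜 := ℝ) _
  have hJ : ∀ x, jacobianDet u x = ∑ σ : Equiv.Perm ι, ((Equiv.Perm.sign σ : ℤ) : ℝ) *
      ((∏ i ∈ Finset.univ.erase k, partialDeriv (σ i) (u i) x) * partialDeriv (σ k) (u k) x) := by
    intro x
    rw [jacobianDet, Matrix.det_apply']
    refine Finset.sum_congr rfl fun σ _ => ?_
    rw [Finset.prod_erase_mul _ _ (Finset.mem_univ k)]
    rfl
  have hdP : ∀ (σ : Equiv.Perm ι) (j : ι), Continuous (partialDeriv j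
      (fun y => ∏ i ∈ Finset.univ.erase k, partialDeriv (σ i) (u i) y)) := fun σ j =>
    (contDiff_partialDeriv (n := 0) (by exact_mod_cast hP σ) j).continuous
  have hint : ∀ σ : Equiv.Perm ι, Integrable (fun x => ((Equiv.Perm.sign σ : ℤ) : ℝ) *
      ((∏ i ∈ Finset.univ.erase k, partialDeriv (σ i) (u i) x) * partialDeriv (σ k) (u k) x)) := by
    intro σ
    refine Integrable.const_mul ?_ _
    exact ((hP σ).continuous.mul (h1 k _).continuous).integrable_of_hasCompactSupport
      (hk' _).mul_left
  have hint' : ∀ σ : Equiv.Perm ι, Integrable (fun x =>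
      partialDeriv (σ k) (fun y => ∏ i ∈ Finset.univ.erase k, partialDeriv (σ i) (u i) y) x
        * u k x) := fun σ =>
    ((hdP σ _).mul (hu k).continuous).integrable_of_hasCompactSupport hk.mul_left
  simp_rw [hJ]
  rw [integral_finsetSum _ fun σ _ => hint σ]
  have hibp : ∀ σ : Equiv.Perm ι, ∫ x, ((Equiv.Perm.sign σ : ℤ) : ℝ) *
      ((∏ i ∈ Finset.univ.erase k, partialDeriv (σ i) (u i) x) * partialDeriv (σ k) (u k) x) =
      ∫ x, - (((Equiv.Perm.sign σ : ℤ) : ℝ) *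
      partialDeriv (σ k) (fun y => ∏ i ∈ Finset.univ.erase k, partialDeriv (σ i) (u i) y) x
        * u k x) := by
    intro σ
    rw [integral_const_mul, integral_neg]
    simp_rw [mul_assoc]
    rw [integral_const_mul, ← mul_neg]
    congr 1
    refine integral_mul_fderiv_eq_neg_fderiv_mul_of_integrable (v := Pi.single (σ k) 1)
      (hint' σ) ?_ ?_ (fun x _ => (hP σ).differentiable (by norm_num) x)
      (fun x _ => (hu k).differentiable (by norm_num) x)
    · exact ((hP σ).continuous.mul (h1 k _).continuous).integrable_of_hasCompactSupport
        (hk' _).mul_left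
    · exact ((hP σ).continuous.mul (hu k).continuous).integrable_of_hasCompactSupport
        hk.mul_left
  simp_rw [hibp]
  rw [← integral_finsetSum]
  · simp_rw [Finset.sum_neg_distrib, ← Finset.sum_mul, sum_sign_mul_partialDeriv_cofactor hu]
    simp
  · intro σ _
    simp_rw [mul_assoc]
    exact ((hint' σ).const_mul _).neg

lemma hasDerivAt_det_add_smul (M D : Matrix ι ι ℝ) (t : ℝ) :
    HasDerivAt (fun s : ℝ => (M + s • D).det)
      (∑ k, ((M + t • D).updateCol k fun j => D j k).det) t := by
  have h : ∀ σ : Equiv.Perm ι, HasDerivAt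
      (fun s : ℝ => ((Equiv.Perm.sign σ : ℤ) : ℝ) * ∏ i, (M + s • D) (σ i) i)
      (((Equiv.Perm.sign σ : ℤ) : ℝ) *
        ∑ k, (∏ i ∈ Finset.univ.erase k, (M + t • D) (σ i) i) * D (σ k) k) t := by
    intro σ
    refine HasDerivAt.const_mul _ ?_
    have := HasDerivAt.fun_finsetProd (u := Finset.univ) (f := fun i (s : ℝ) => (M + s • D) (σ i) i)
      (f' := fun i => D (σ i) i) (x := t) (fun i _ => by
        simpa using ((hasDerivAt_id t).mul_const (D (σ i) i)).const_add (M (σ i) i))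
    simpa using this
  have h2 := HasDerivAt.fun_sum (u := Finset.univ) fun σ _ => h σ
  simp_rw [Matrix.det_apply']
  refine h2.congr_deriv ?_
  simp_rw [Finset.mul_sum]
  rw [Finset.sum_comm]
  refine Finset.sum_congr rfl fun k _ => Finset.sum_congr rfl fun σ _ => ?_
  congr 1
  rw [← Finset.prod_erase_mul _ _ (Finset.mem_univ k)]
  congr 1
  · refine Finset.prod_congr rfl fun i hi => ?_
    rw [Matrix.updateCol_ne (Finset.ne_of_mem_erase hi)]
  · simp

lemma partialDeriv_eq_sum {ρ : (ι → ℝ) → ℝ} (hρ : ContDiff ℝ 2 ρ) {F : (ι → ℝ) → ι → ℝ}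
    (hF : ContDiff ℝ 2 F) (j : ι) (x : ι → ℝ) :
    partialDeriv j (fun y => ρ (F y)) x =
      ∑ l, partialDeriv l ρ (F x) * partialDeriv j (fun y => F y l) x := by
  have hFd : DifferentiableAt ℝ F x := hF.differentiable (by norm_num) x
  unfold partialDeriv
  have h := fderiv_comp x (hρ.differentiable (by norm_num) (F x)) hFd
  simp only [Function.comp_def] at h
  rw [h]
  simp only [ContinuousLinearMap.comp_apply]
  conv_lhs => rw [← Finset.univ_sum_single (fderiv ℝ F x (Pi.single j 1)), map_sum]
  refine Finset.sum_congr rfl fun l _ => ?_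
  have : fderiv ℝ (fun y => F y l) x (Pi.single j 1) = fderiv ℝ F x (Pi.single j 1) l := by
    rw [fderiv_pi (differentiableAt_pi.1 hFd)]; simp
  rw [this]
  have : (Pi.single l (fderiv ℝ F x (Pi.single j 1) l) : ι → ℝ) =
      (fderiv ℝ F x (Pi.single j 1) l) • Pi.single l 1 := by
    ext i; simp [Pi.single_apply]
  rw [this, map_smul, smul_eq_mul, mul_comm]

lemma jacobianDet_update_mul {ρ : (ι → ℝ) → ℝ} (hρ : ContDiff ℝ 2 ρ) {F : (ι → ℝ) → ι → ℝ}
    (hF : ContDiff ℝ 2 F) {g : (ι → ℝ) → ℝ} (hg : ContDiff ℝ 2 g) (k : ι) (x : ι → ℝ) :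
    jacobianDet (Function.update (fun i y => F y i) k fun y => ρ (F y) * g y) x =
      ρ (F x) * ((Matrix.of fun j i => partialDeriv j (fun y => F y i) x).updateCol k
        fun j => partialDeriv j g x).det +
      g x * partialDeriv k ρ (F x) * jacobianDet (fun i y => F y i) x := by
  set M : Matrix ι ι ℝ := Matrix.of fun j i => partialDeriv j (fun y => F y i) x with hM
  have h1 : (Matrix.of fun j i => partialDeriv j
      (Function.update (fun i y => F y i) k (fun y => ρ (F y) * g y) i) x) =
      M.updateCol k (ρ (F x) • (fun j => partialDeriv j g x) +
        g x • ∑ l, partialDeriv l ρ (F x) • fun j => M j l) := by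
    ext j i
    by_cases hi : i = k
    · subst hi
      simp only [of_apply, Function.update_self, updateCol_self, Pi.add_apply, Pi.smul_apply,
        smul_eq_mul, Finset.sum_apply]
      have hρF : DifferentiableAt ℝ (fun y => ρ (F y)) x :=
        (hρ.comp hF).differentiable (by norm_num) x
      have hgd : DifferentiableAt ℝ g x := hg.differentiable (by norm_num) x
      have : partialDeriv j (fun y => ρ (F y) * g y) x =
          ρ (F x) * partialDeriv j g x + g x * partialDeriv j (fun y => ρ (F y)) x := by
        unfold partialDeriv
        rw [fderiv_fun_mul hρF hgd]
        simp
      rw [this, partialDeriv_eq_sum hρ hF]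
      rfl
    · simp [hi, hM]
  unfold jacobianDet
  rw [h1, det_updateCol_add, det_updateCol_smul, det_updateCol_smul]
  congr 1
  rw [mul_assoc]
  congr 1
  have h2 : (∑ l, partialDeriv l ρ (F x) • fun j => M j l : ι → ℝ) =
      fun j => ∑ l, partialDeriv l ρ (F x) • M j l := by
    ext j; simp
  rw [h2, det_updateCol_sum]
  rfl

lemma jacobianDet_update_indicator {U : Set (ι → ℝ)} (hU : IsOpen U)
    (u : ι → (ι → ℝ) → ℝ) (k : ι) {g : (ι → ℝ) → ℝ} (h : ∀ x ∈ frontier U, g =ᶠ[𝓝 x] 0)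
    (x : ι → ℝ) :
    jacobianDet (Function.update u k (U.indicator g)) x =
      U.indicator (jacobianDet (Function.update u k g)) x := by
  by_cases hx : x ∈ U
  · rw [Set.indicator_of_mem hx]
    unfold jacobianDet
    congr 1
    ext j i
    by_cases hi : i = k
    · subst hi
      simp only [of_apply, Function.update_self, partialDeriv]
      rw [(indicator_eventuallyEq_self (by rwa [hU.interior_eq])).fderiv_eq]
    · simp [hi]
  · rw [Set.indicator_of_notMem hx]
    refine det_eq_zero_of_column_eq_zero k fun j => ?_
    simp only [of_apply, Function.update_self, partialDeriv]
    rw [(indicator_eventuallyEq_zero h (by rwa [hU.interior_eq])).fderiv_eq]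
    simp

lemma setIntegral_jacobianDet_eq_zero {U : Set (ι → ℝ)} (hU : IsOpen U)
    (hUb : Bornology.IsBounded U) {u : ι → (ι → ℝ) → ℝ} (hu : ∀ i, ContDiff ℝ 2 (u i))
    (k : ι) {g : (ι → ℝ) → ℝ} (hg : ContDiff ℝ 2 g) (h : ∀ x ∈ frontier U, g =ᶠ[𝓝 x] 0) :
    ∫ x in U, jacobianDet (Function.update u k g) x = 0 := by
  rw [← integral_indicator hU.measurableSet]
  simp_rw [← jacobianDet_update_indicator hU u k h]
  refine integral_jacobianDet_eq_zero (k := k) (fun i => ?_) ?_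
  · by_cases hi : i = k
    · subst hi
      simpa using contDiff_indicator hg h
    · simpa [hi] using hu i
  · rw [Function.update_self]
    exact HasCompactSupport.intro hUb.isCompact_closure fun x hx =>
      Set.indicator_of_notMem (fun h' => hx (subset_closure h')) _

lemma setIntegral_comp_mul_jacobianDet_eq {U : Set (ι → ℝ)} (hU : IsOpen U)
    (hUb : Bornology.IsBounded U) {ρ : (ι → ℝ) → ℝ} (hρ : ContDiff ℝ 2 ρ)
    {F₀ G : (ι → ℝ) → ι → ℝ} (hF₀ : ContDiff ℝ 2 F₀) (hG : ContDiff ℝ 2 G)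
    (h : ∀ t ∈ Set.Icc (0 : ℝ) 1, ∀ x ∈ frontier U,
      (fun y => ρ (F₀ y + t • G y)) =ᶠ[𝓝 x] 0) :
    ∫ x in U, ρ (F₀ x + (1 : ℝ) • G x) * jacobianDet (fun i y => (F₀ y + (1 : ℝ) • G y) i) x =
      ∫ x in U, ρ (F₀ x + (0 : ℝ) • G x) * jacobianDet (fun i y => (F₀ y + (0 : ℝ) • G y) i) x := by
  have hF : ∀ t : ℝ, ContDiff ℝ 2 (fun y => F₀ y + t • G y) := fun t =>
    hF₀.add (hG.const_smul t)
  have hF₀i : ∀ i, ContDiff ℝ 2 (fun y => F₀ y i) := contDiff_pi.1 hF₀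
  have hGi : ∀ i, ContDiff ℝ 2 (fun y => G y i) := contDiff_pi.1 hG
  let M : (ι → ℝ) → Matrix ι ι ℝ := fun x => of fun j i => partialDeriv j (fun y => F₀ y i) x
  let D : (ι → ℝ) → Matrix ι ι ℝ := fun x => of fun j i => partialDeriv j (fun y => G y i) x
  have hM : Continuous M := continuous_matrix fun j i =>
    (contDiff_partialDeriv (n := 1) (by exact_mod_cast hF₀i i) j).continuous
  have hD : Continuous D := continuous_matrix fun j i =>
    (contDiff_partialDeriv (n := 1) (by exact_mod_cast hGi i) j).continuous
  have hρ' : ∀ k, Continuous (partialDeriv k ρ) := fun k =>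
    (contDiff_partialDeriv (n := 1) (by exact_mod_cast hρ) k).continuous
  have hMD : ∀ (t : ℝ) x, (of fun j i => partialDeriv j (fun y => (F₀ y + t • G y) i) x) =
      M x + t • D x := by
    intro t x
    ext j i
    simp only [of_apply, Matrix.add_apply, Matrix.smul_apply, M, D, partialDeriv, Pi.add_apply,
      Pi.smul_apply, smul_eq_mul]
    rw [fderiv_fun_add ((hF₀i i).differentiable (by norm_num) x)
      (((hGi i).differentiable (by norm_num) x).const_mul t),
      fderiv_const_mul ((hGi i).differentiable (by norm_num) x)]
    simp
  let Φ : ℝ → (ι → ℝ) → ℝ := fun t x => ∑ k,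
    (ρ (F₀ x + t • G x) * ((M x + t • D x).updateCol k fun j => D x j k).det +
      G x k * partialDeriv k ρ (F₀ x + t • G x) * (M x + t • D x).det)
  have hΦc : Continuous fun z : (ι → ℝ) × ℝ => Φ z.2 z.1 := by
    have hFc : Continuous fun z : (ι → ℝ) × ℝ => F₀ z.1 + z.2 • G z.1 :=
      (hF₀.continuous.comp continuous_fst).add
        (continuous_snd.smul (hG.continuous.comp continuous_fst))
    have hMc : Continuous fun z : (ι → ℝ) × ℝ => M z.1 + z.2 • D z.1 :=
      (hM.comp continuous_fst).add (continuous_snd.smul (hD.comp continuous_fst))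
    refine continuous_finsetSum _ fun k _ => ?_
    refine ((hρ.continuous.comp hFc).mul ?_).add ?_
    · refine (hMc.matrix_updateCol k ?_).matrix_det
      exact continuous_pi fun j => (hD.comp continuous_fst).matrix_elem j k
    · exact (((continuous_apply k).comp (hG.continuous.comp continuous_fst)).mul
        ((hρ' k).comp hFc)).mul hMc.matrix_det
  have hΦ : ∀ t x, Φ t x = ∑ k, jacobianDet (Function.update (fun i y => (F₀ y + t • G y) i) k
      fun y => ρ (F₀ y + t • G y) * G y k) x := by
    intro t x
    refine Finset.sum_congr rfl fun k _ => ?_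
    rw [jacobianDet_update_mul hρ (hF t) (hGi k), jacobianDet, hMD]
    rfl
  have hder : ∀ x t, HasDerivAt (fun t : ℝ => ρ (F₀ x + t • G x) * (M x + t • D x).det)
      (Φ t x) t := by
    intro x t
    have h1 : HasDerivAt (fun t : ℝ => F₀ x + t • G x) (G x) t := by
      simpa using ((hasDerivAt_id t).smul_const (G x)).const_add (F₀ x)
    have h2 : HasDerivAt (fun t : ℝ => ρ (F₀ x + t • G x))
        (fderiv ℝ ρ (F₀ x + t • G x) (G x)) t :=
      (hρ.differentiable (by norm_num) _).hasFDerivAt.comp_hasDerivAt t h1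
    refine (h2.mul (hasDerivAt_det_add_smul (M x) (D x) t)).congr_deriv ?_
    have h3 : fderiv ℝ ρ (F₀ x + t • G x) (G x) =
        ∑ k, G x k * partialDeriv k ρ (F₀ x + t • G x) := by
      unfold partialDeriv
      generalize fderiv ℝ ρ (F₀ x + t • G x) = L
      conv_lhs => rw [← Finset.univ_sum_single (G x), map_sum]
      refine Finset.sum_congr rfl fun k _ => ?_
      have : (Pi.single k (G x k) : ι → ℝ) = G x k • Pi.single k 1 := by
        ext i; simp [Pi.single_apply]
      rw [this, map_smul, smul_eq_mul]
    simp only [Φ, Finset.sum_add_distrib, h3, Finset.mul_sum, Finset.sum_mul]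
    ring
  have hzero : ∀ t ∈ Set.Icc (0 : ℝ) 1, ∫ x in U, Φ t x = 0 := by
    intro t ht
    simp_rw [hΦ]
    have hg : ∀ k, ContDiff ℝ 2 fun y => ρ (F₀ y + t • G y) * G y k := fun k =>
      (hρ.comp (hF t)).mul (hGi k)
    rw [integral_finsetSum]
    · refine Finset.sum_eq_zero fun k _ => ?_
      refine setIntegral_jacobianDet_eq_zero hU hUb (contDiff_pi.1 (hF t)) k (hg k) ?_
      intro x hx
      filter_upwards [h t ht x hx] with y hy
      simp [hy]
    · intro k _
      refine ((Continuous.continuousOn ?_).integrableOn_compact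
        hUb.isCompact_closure).mono_set subset_closure
      refine Continuous.matrix_det (continuous_matrix fun j i => ?_)
      by_cases hi : i = k
      · subst hi
        simpa using (contDiff_partialDeriv (n := 1) (by exact_mod_cast hg i) j).continuous
      · simpa [hi] using
          (contDiff_partialDeriv (n := 1) (by exact_mod_cast contDiff_pi.1 (hF t) i) j).continuous
  have hψ : ∀ (t : ℝ), IntegrableOn (fun x => ρ (F₀ x + t • G x) * (M x + t • D x).det) U := by
    intro t
    refine ((Continuous.continuousOn ?_).integrableOn_compact
        hUb.isCompact_closure).mono_set subset_closure
    exact (hρ.continuous.comp (hF t).continuous).mul (hM.add (hD.const_smul t)).matrix_det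
  simp_rw [jacobianDet, hMD]
  rw [← sub_eq_zero, ← integral_sub (hψ 1) (hψ 0)]
  have hftc : ∀ x, ρ (F₀ x + (1 : ℝ) • G x) * (M x + (1 : ℝ) • D x).det -
      ρ (F₀ x + (0 : ℝ) • G x) * (M x + (0 : ℝ) • D x).det =
      ∫ t in Set.Ioc (0 : ℝ) 1, Φ t x := by
    intro x
    rw [← intervalIntegral.integral_of_le zero_le_one]
    refine (intervalIntegral.integral_eq_sub_of_hasDerivAt (fun t _ => hder x t) ?_).symm
    exact (hΦc.comp (continuous_const.prodMk continuous_id)).intervalIntegrable _ _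
  simp_rw [hftc]
  rw [integral_integral_swap]
  · exact setIntegral_eq_zero_of_forall_eq_zero fun t ht => hzero t (Set.Ioc_subset_Icc_self ht)
  · rw [Measure.prod_restrict]
    exact ((hΦc.continuousOn).integrableOn_compact
      (hUb.isCompact_closure.prod (isCompact_Icc (a := (0 : ℝ)) (b := 1)))).mono_set
      (Set.prod_mono subset_closure Set.Ioc_subset_Icc_self)

lemma exists_norm_lower_bound {X E : Type*} [TopologicalSpace X] [NormedAddCommGroup E]
    {S : Set X} (hS : IsCompact S) {f : X → E} (hf : ContinuousOn f S)
    (h0 : ∀ x ∈ S, f x ≠ 0) : ∃ ε > 0, ∀ x ∈ S, ε ≤ ‖f x‖ := by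
  rcases S.eq_empty_or_nonempty with rfl | hne
  · exact ⟨1, one_pos, by simp⟩
  · obtain ⟨x, hx, hmin⟩ := hS.exists_isMinOn hne hf.norm
    exact ⟨‖f x‖, norm_pos_iff.mpr (h0 x hx), fun y hy => hmin hy⟩

/-- A homotopy invariance property of the degree: if `F₀` has at least one zero in `U`, has
positive Jacobian determinant at each of its zeros, and the segment from `F₀` to `F₁` has no zero
on the boundary of `U`, then `F₁` has a zero in `U`. -/
theorem exists_zero_of_segment_ne_zero {U : Set (ι → ℝ)} (hU : IsOpen U)
    (hUb : Bornology.IsBounded U) {F₀ F₁ : (ι → ℝ) → ι → ℝ} (hF₀ : ContDiff ℝ 2 F₀)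
    (hF₁ : ContDiff ℝ 2 F₁)
    (hbd : ∀ t ∈ Set.Icc (0 : ℝ) 1, ∀ x ∈ frontier U, F₀ x + t • (F₁ x - F₀ x) ≠ 0)
    (hdet : ∀ x ∈ U, F₀ x = 0 → 0 < jacobianDet (fun i y => F₀ y i) x)
    (hex : ∃ x ∈ U, F₀ x = 0) : ∃ x ∈ U, F₁ x = 0 := by
  by_contra! hno
  have hKc : IsCompact (closure U) := hUb.isCompact_closure
  have hfr : IsCompact (frontier U) := hKc.of_isClosed_subset isClosed_frontier
    frontier_subset_closure
  have hcl : ∀ x ∈ closure U, x ∈ U ∨ x ∈ frontier U := fun x hx => by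
    by_cases h : x ∈ U
    · exact Or.inl h
    · exact Or.inr ⟨hx, by rwa [hU.interior_eq]⟩
  have hJc : Continuous (jacobianDet fun i y => F₀ y i) :=
    Continuous.matrix_det (continuous_matrix fun j i =>
      (contDiff_partialDeriv (n := 1) (by exact_mod_cast contDiff_pi.1 hF₀ i) j).continuous)
  have hcont : Continuous fun z : ℝ × (ι → ℝ) => F₀ z.2 + z.1 • (F₁ z.2 - F₀ z.2) :=
    (hF₀.continuous.comp continuous_snd).add (continuous_fst.smul
      ((hF₁.continuous.comp continuous_snd).sub (hF₀.continuous.comp continuous_snd)))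
  obtain ⟨ε₁, hε₁, h1⟩ := exists_norm_lower_bound
    ((isCompact_Icc (a := (0 : ℝ)) (b := 1)).prod hfr) hcont.continuousOn
    (fun z hz => hbd z.1 hz.1 z.2 hz.2)
  obtain ⟨ε₂, hε₂, h2⟩ := exists_norm_lower_bound hKc hF₁.continuous.continuousOn (fun x hx => by
    rcases hcl x hx with h | h
    · exact hno x h
    · simpa using hbd 1 (by simp) x h)
  obtain ⟨ε₃, hε₃, h3⟩ := exists_norm_lower_bound
    (hKc.inter_right (isClosed_le hJc continuous_const (g := fun _ => (0 : ℝ))))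
    hF₀.continuous.continuousOn (fun x hx => by
      rcases hcl x hx.1 with h | h
      · intro h0
        exact absurd (hdet x h h0) (not_lt.mpr hx.2)
      · simpa using hbd 0 (by simp) x h)
  set ε := min ε₁ (min ε₂ ε₃) with hε
  have hεpos : 0 < ε := lt_min hε₁ (lt_min hε₂ hε₃)
  let ρ : ContDiffBump (0 : ι → ℝ) := ⟨ε / 4, ε / 2, by positivity, by linarith⟩
  have hρ0 : ∀ v : ι → ℝ, ε / 2 ≤ ‖v‖ → ρ v = 0 := fun v hv =>
    ρ.zero_of_le_dist (by simpa using hv)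
  have key := setIntegral_comp_mul_jacobianDet_eq hU hUb (ρ := ρ) ρ.contDiff hF₀ (hF₁.sub hF₀)
    (by
      intro t ht x hx
      have hlt : ε / 2 < ‖F₀ x + t • (F₁ x - F₀ x)‖ := by
        have := h1 (t, x) ⟨ht, hx⟩
        have h' : ε ≤ ε₁ := min_le_left _ _
        simp only at this
        linarith
      have hc : Continuous fun y => ‖F₀ y + t • (F₁ y - F₀ y)‖ :=
        (hcont.comp (continuous_const.prodMk continuous_id)).norm
      filter_upwards [hc.continuousAt.eventually (lt_mem_nhds hlt)] with y hy
      exact hρ0 _ hy.le)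
  have hI1 : ∫ x in U, ρ (F₀ x + (1 : ℝ) • (F₁ x - F₀ x)) *
      jacobianDet (fun i y => (F₀ y + (1 : ℝ) • (F₁ y - F₀ y)) i) x = 0 := by
    refine setIntegral_eq_zero_of_forall_eq_zero fun x hx => ?_
    have := h2 x (subset_closure hx)
    have h' : ε ≤ ε₂ := (min_le_right _ _).trans (min_le_left _ _)
    rw [hρ0 _ (by simp only [one_smul, add_sub_cancel]; linarith), zero_mul]
  have hI0 : 0 < ∫ x in U, ρ (F₀ x) * jacobianDet (fun i y => F₀ y i) x := by
    have hcψ : Continuous fun x => ρ (F₀ x) * jacobianDet (fun i y => F₀ y i) x :=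
      (ρ.continuous.comp hF₀.continuous).mul hJc
    have hpos : ∀ x ∈ U, 0 ≤ ρ (F₀ x) * jacobianDet (fun i y => F₀ y i) x := by
      intro x hx
      by_cases hJ : jacobianDet (fun i y => F₀ y i) x ≤ 0
      · have := h3 x ⟨subset_closure hx, hJ⟩
        have h' : ε ≤ ε₃ := (min_le_right _ _).trans (min_le_right _ _)
        rw [hρ0 _ (by linarith), zero_mul]
      · exact mul_nonneg ρ.nonneg (not_le.mp hJ).le
    rw [setIntegral_pos_iff_support_of_nonneg_ae]
    · obtain ⟨x₀, hx₀, hz⟩ := hex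
      have hsub : {x | 0 < ρ (F₀ x) * jacobianDet (fun i y => F₀ y i) x} ∩ U ⊆
          Function.support (fun x => ρ (F₀ x) * jacobianDet (fun i y => F₀ y i) x) ∩ U :=
        Set.inter_subset_inter_left _ fun x hx => ne_of_gt hx
      refine lt_of_lt_of_le ?_ (measure_mono hsub)
      refine ((isOpen_lt continuous_const hcψ).inter hU).measure_pos _ ⟨x₀, ?_, hx₀⟩
      simp only [Set.mem_ofPred_eq, hz]
      refine mul_pos ?_ (hdet x₀ hx₀ hz)
      rw [ρ.one_of_mem_closedBall (by simpa using ρ.rIn_pos.le)]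
      exact one_pos
    · exact (ae_restrict_mem hU.measurableSet).mono fun x hx => hpos x hx
    · exact (hcψ.continuousOn.integrableOn_compact hKc).mono_set subset_closure
  rw [hI1] at key
  simp only [zero_smul, add_zero] at key
  exact hI0.ne key

/-- The coordinate-free form of `exists_zero_of_segment_ne_zero`. -/
theorem exists_zero_of_segment_ne_zero' {E : Type*} [NormedAddCommGroup E] [NormedSpace ℝ E]
    [FiniteDimensional ℝ E] {U : Set E} (hU : IsOpen U)
    (hUb : Bornology.IsBounded U) {F₀ F₁ : E → E} (hF₀ : ContDiff ℝ 2 F₀)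
    (hF₁ : ContDiff ℝ 2 F₁)
    (hbd : ∀ t ∈ Set.Icc (0 : ℝ) 1, ∀ x ∈ frontier U, F₀ x + t • (F₁ x - F₀ x) ≠ 0)
    (hdet : ∀ x ∈ U, F₀ x = 0 → 0 < LinearMap.det (fderiv ℝ F₀ x : E →ₗ[ℝ] E))
    (hex : ∃ x ∈ U, F₀ x = 0) : ∃ x ∈ U, F₁ x = 0 := by
  let b := Module.finBasis ℝ E
  let e : E ≃L[ℝ] (Fin (Module.finrank ℝ E) → ℝ) := b.equivFunL
  have hpre : frontier (e.symm ⁻¹' U) = e.symm ⁻¹' frontier U :=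
    (e.symm.toHomeomorph.preimage_frontier U).symm
  have hb : Bornology.IsBounded (e.symm ⁻¹' U) := by
    rw [← e.image_eq_preimage_symm]
    exact e.lipschitz.isBounded_image hUb
  have key := exists_zero_of_segment_ne_zero (U := e.symm ⁻¹' U)
    (F₀ := fun x => e (F₀ (e.symm x))) (F₁ := fun x => e (F₁ (e.symm x)))
    (hU.preimage e.symm.continuous) hb
    (e.contDiff.comp (hF₀.comp e.symm.contDiff)) (e.contDiff.comp (hF₁.comp e.symm.contDiff))
    (by
      intro t ht x hx h
      rw [hpre] at hx
      refine hbd t ht _ hx (e.injective ?_)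
      rw [map_add, map_smul, map_sub, h, map_zero])
    (by
      intro x hx hx0
      have h0 : F₀ (e.symm x) = 0 := e.injective (by rw [hx0, map_zero])
      refine (hdet _ hx h0).trans_eq ?_
      have hd : DifferentiableAt ℝ (fun x => e (F₀ (e.symm x))) x :=
        (e.contDiff.comp (hF₀.comp e.symm.contDiff)).differentiable (by norm_num) x
      have hfd : HasFDerivAt (fun x => e (F₀ (e.symm x)))
          ((e : E →L[ℝ] _).comp ((fderiv ℝ F₀ (e.symm x)).comp (e.symm : _ →L[ℝ] E))) x :=
        e.hasFDerivAt.comp x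
          ((hF₀.differentiable (by norm_num) (e.symm x)).hasFDerivAt.comp x
            e.symm.hasFDerivAt)
      rw [jacobianDet, ← det_transpose, ← LinearMap.det_toMatrix b]
      congr 1
      ext i j
      simp only [LinearMap.toMatrix_apply, transpose_apply, of_apply, partialDeriv]
      rw [show fderiv ℝ (fun y => e (F₀ (e.symm y)) i) x =
        (ContinuousLinearMap.proj i).comp (fderiv ℝ (fun y => e (F₀ (e.symm y))) x) from by
          rw [fderiv_pi (differentiableAt_pi.1 hd)]; rfl]
      rw [hfd.fderiv]
      have : e.symm (Pi.single j 1) = b j := by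
        rw [ContinuousLinearEquiv.symm_apply_eq]
        ext k
        simp [e, Pi.single_apply, Finsupp.single_apply, eq_comm]
      simp [this, e])
    (by
      obtain ⟨x, hx, h⟩ := hex
      exact ⟨e x, by simpa using hx, by simp [h]⟩)
  obtain ⟨x, hx, h⟩ := key
  exact ⟨e.symm x, hx, e.injective (by rw [h, map_zero])⟩

/-- An injective operator with nonnegative symmetric part has positive determinant. -/
lemma LinearMap.det_pos_of_bilin_nonneg {E : Type*} [AddCommGroup E] [Module ℝ E]
    [FiniteDimensional ℝ E] (B : E →ₗ[ℝ] E →ₗ[ℝ] ℝ) (hB : ∀ x, x ≠ 0 → 0 < B x x)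
    (T : E →ₗ[ℝ] E) (hT : ∀ x, 0 ≤ B x (T x)) (hinj : ∀ x, T x = 0 → x = 0) :
    0 < LinearMap.det T := by
  let f : ℝ → ℝ := fun t => LinearMap.det ((1 - t) • T + t • LinearMap.id)
  have hf : Continuous f := by
    let b := Module.finBasis ℝ E
    have : f = fun t => ((1 - t) • LinearMap.toMatrix b b T + t • (1 : Matrix _ _ ℝ)).det := by
      ext t
      simp only [f]
      rw [← LinearMap.det_toMatrix b, map_add, map_smul, map_smul, LinearMap.toMatrix_id]
    rw [this]
    fun_prop
  have hne : ∀ t ∈ Set.Icc (0 : ℝ) 1, f t ≠ 0 := by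
    intro t ht h0
    obtain ⟨x, hx, hxn⟩ := Submodule.exists_mem_ne_zero_of_ne_bot
      (LinearMap.bot_lt_ker_of_det_eq_zero h0).ne'
    rw [LinearMap.mem_ker] at hx
    simp only [LinearMap.add_apply, LinearMap.smul_apply, LinearMap.id_apply] at hx
    rcases eq_or_lt_of_le ht.1 with h | h
    · subst h
      exact hxn (hinj x (by simpa using hx))
    · have := congrArg (B x) hx
      simp only [map_add, map_smul, smul_eq_mul, map_zero] at this
      have h1 : 0 ≤ (1 - t) * B x (T x) := mul_nonneg (by linarith [ht.2]) (hT x)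
      have h2 := mul_pos h (hB x hxn)
      linarith
  by_contra! hle
  have h0 : f 0 ≤ 0 := by simpa [f] using hle
  have h1 : f 1 = 1 := by simp [f]
  obtain ⟨t, ht, h⟩ := intermediate_value_Icc zero_le_one hf.continuousOn
    (show (0 : ℝ) ∈ Set.Icc (f 0) (f 1) from ⟨h0, by rw [h1]; exact zero_le_one⟩)
  exact hne t ht h

end Degree

section Approximation

/-- Simultaneous smooth approximation: a continuous map on a compact subset (given by an injective
continuous map `f`) is uniformly approximated by restrictions of smooth maps. -/
lemma exists_contDiff_approx {C E V : Type*} [TopologicalSpace C] [CompactSpace C]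
    [NormedAddCommGroup E] [NormedSpace ℝ E] [NormedAddCommGroup V] [NormedSpace ℝ V]
    [FiniteDimensional ℝ V] {f : C → E} (hf : Continuous f) (hinj : Function.Injective f)
    {b : C → V} (hb : Continuous b) {ε : ℝ} (hε : 0 < ε) :
    ∃ P : E → V, ContDiff ℝ 2 P ∧ ∀ x, ‖P (f x) - b x‖ < ε := by
  let S : Subalgebra ℝ C(C, ℝ) :=
    { carrier := {g | ∃ P : E → ℝ, ContDiff ℝ 2 P ∧ ∀ x, g x = P (f x)}
      mul_mem' := by
        rintro g₁ g₂ ⟨P₁, h₁, e₁⟩ ⟨P₂, h₂, e₂⟩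
        exact ⟨fun z => P₁ z * P₂ z, h₁.mul h₂, fun x => by simp [e₁, e₂]⟩
      add_mem' := by
        rintro g₁ g₂ ⟨P₁, h₁, e₁⟩ ⟨P₂, h₂, e₂⟩
        exact ⟨fun z => P₁ z + P₂ z, h₁.add h₂, fun x => by simp [e₁, e₂]⟩
      algebraMap_mem' := fun r => ⟨fun _ => r, contDiff_const, fun x => rfl⟩ }
  have hS : S.SeparatesPoints := by
    intro x y hxy
    obtain ⟨L, hL⟩ := SeparatingDual.exists_ne_zero (R := ℝ) (sub_ne_zero.mpr (hinj.ne hxy))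
    refine ⟨fun x => L (f x), ⟨⟨fun x => L (f x), L.continuous.comp hf⟩,
      ⟨L, L.contDiff, fun _ => rfl⟩, rfl⟩, fun h => hL ?_⟩
    rw [map_sub, show L (f x) = L (f y) from h, sub_self]
  let e : V ≃L[ℝ] (Fin (Module.finrank ℝ V) → ℝ) := (Module.finBasis ℝ V).equivFunL
  obtain ⟨M, hM, hMb⟩ : ∃ M > 0, ∀ v, ‖e.symm v‖ ≤ M * ‖v‖ :=
    (e.symm : (Fin (Module.finrank ℝ V) → ℝ) →L[ℝ] V).bound
  have happ : ∀ i, ∃ P : E → ℝ, ContDiff ℝ 2 P ∧ ∀ x, ‖P (f x) - e (b x) i‖ < ε / M := by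
    intro i
    obtain ⟨⟨g, P, hP, hg⟩, h⟩ :=
      ContinuousMap.exists_mem_subalgebra_near_continuous_of_separatesPoints S hS
        (fun x => e (b x) i) ((continuous_apply i).comp (e.continuous.comp hb)) (ε / M)
        (by positivity)
    exact ⟨P, hP, fun x => by rw [← hg]; exact h x⟩
  choose P hP hPb using happ
  refine ⟨fun z => e.symm fun i => P i z, e.symm.contDiff.comp (contDiff_pi.2 hP), fun x => ?_⟩
  have h1 : e.symm (fun i => P i (f x)) - b x = e.symm ((fun i => P i (f x)) - e (b x)) := by
    rw [map_sub, e.symm_apply_apply]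
  rw [h1]
  calc _ ≤ M * ‖(fun i => P i (f x)) - e (b x)‖ := hMb _
    _ < M * (ε / M) := by
        refine mul_lt_mul_of_pos_left ?_ hM
        exact (pi_norm_lt_iff (by positivity)).2 fun i => hPb i x
    _ = ε := by field_simp

end Approximation

section Orbit

open scoped Matrix.Norms.L2Operator MatrixOrder ComplexOrder
open Topology

variable {N : Type*} [Fintype N] [DecidableEq N]

/-- The self-adjoint matrices fixed by `σ`. -/
def fixedSelfAdjoint (σ : Matrix N N ℂ →⋆ₐ[ℝ] Matrix N N ℂ) : Submodule ℝ (Matrix N N ℂ) where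
  carrier := {Z | Zᴴ = Z ∧ σ Z = Z}
  add_mem' := by
    rintro a b ⟨h1, h2⟩ ⟨h3, h4⟩
    exact ⟨by rw [conjTranspose_add, h1, h3], by rw [map_add, h2, h4]⟩
  zero_mem' := ⟨conjTranspose_zero, map_zero _⟩
  smul_mem' := by
    rintro c a ⟨h1, h2⟩
    exact ⟨by rw [conjTranspose_smul, h1, star_trivial], by rw [map_smul, h2]⟩

/-- The skew-adjoint matrices fixed by `σ`. -/
def fixedSkewAdjoint (σ : Matrix N N ℂ →⋆ₐ[ℝ] Matrix N N ℂ) : Submodule ℝ (Matrix N N ℂ) where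
  carrier := {Z | Zᴴ = -Z ∧ σ Z = Z}
  add_mem' := by
    rintro a b ⟨h1, h2⟩ ⟨h3, h4⟩
    exact ⟨by rw [conjTranspose_add, h1, h3, neg_add], by rw [map_add, h2, h4]⟩
  zero_mem' := ⟨by simp, map_zero _⟩
  smul_mem' := by
    rintro c a ⟨h1, h2⟩
    exact ⟨by rw [conjTranspose_smul, h1, star_trivial, smul_neg], by rw [map_smul, h2]⟩

/-- The orbit of `K` under conjugation by the unitary matrices fixed by `σ`. -/
def fixedUnitaryOrbit (σ : Matrix N N ℂ →⋆ₐ[ℝ] Matrix N N ℂ) (K : Matrix N N ℂ) :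
    Set (Matrix N N ℂ) :=
  {X | ∃ u : Matrix N N ℂ, uᴴ * u = 1 ∧ σ u = u ∧ X = u * K * uᴴ}

variable {σ : Matrix N N ℂ →⋆ₐ[ℝ] Matrix N N ℂ} {K : Matrix N N ℂ}

lemma map_conjTranspose (Z : Matrix N N ℂ) : σ Zᴴ = (σ Z)ᴴ := map_star σ Z

lemma fixedUnitaryOrbit_subset (hK : K ∈ fixedSelfAdjoint σ) :
    fixedUnitaryOrbit σ K ⊆ fixedSelfAdjoint σ := by
  rintro X ⟨u, hu, hσ, rfl⟩
  refine ⟨?_, ?_⟩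
  · simp [conjTranspose_mul, hK.1, mul_assoc]
  · rw [map_mul, map_mul, map_conjTranspose, hσ, hK.2]

lemma mul_self_of_mem_fixedUnitaryOrbit (hK2 : K * K = 1) {X : Matrix N N ℂ}
    (hX : X ∈ fixedUnitaryOrbit σ K) : X * X = 1 := by
  obtain ⟨u, hu, -, rfl⟩ := hX
  have hu' : u * uᴴ = 1 := mul_eq_one_comm.mp hu
  calc u * K * uᴴ * (u * K * uᴴ) = u * K * (uᴴ * u) * K * uᴴ := by simp only [mul_assoc]
    _ = u * (K * K) * uᴴ := by rw [hu]; simp only [mul_assoc, one_mul]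
    _ = 1 := by rw [hK2, mul_one, hu']

lemma norm_le_one_of_conjTranspose_mul_self {u : Matrix N N ℂ} (hu : uᴴ * u = 1) : ‖u‖ ≤ 1 := by
  have h := CStarRing.norm_star_mul_self (x := u)
  rw [star_eq_conjTranspose, hu] at h
  by_cases hN : Nontrivial (Matrix N N ℂ)
  · rw [norm_one] at h
    nlinarith [norm_nonneg u]
  · rw [not_nontrivial_iff_subsingleton] at hN
    rw [Subsingleton.elim u 0, norm_zero]
    exact zero_le_one

/-- Local rigidity of involutions under unitary conjugation. -/
lemma mem_fixedUnitaryOrbit_of_norm_sub_lt (hK : K ∈ fixedSelfAdjoint σ) (hK2 : K * K = 1)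
    {X Z : Matrix N N ℂ} (hX : X ∈ fixedUnitaryOrbit σ K) (hZ : Z ∈ fixedSelfAdjoint σ)
    (hZ2 : Z * Z = 1) (hXZ : ‖Z - X‖ < 1) : Z ∈ fixedUnitaryOrbit σ K := by
  have hXE := fixedUnitaryOrbit_subset hK hX
  have hX2 := mul_self_of_mem_fixedUnitaryOrbit hK2 hX
  obtain ⟨v, hv, hσv, rfl⟩ := hX
  set X := v * K * vᴴ with hXdef
  set g := 1 + Z * X with hg
  have hgH : gᴴ = 1 + X * Z := by
    rw [hg, conjTranspose_add, conjTranspose_mul, conjTranspose_one, hXE.1, hZ.1]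
  have hgu : IsUnit g := by
    have hX1 : ‖X‖ ≤ 1 := norm_le_one_of_conjTranspose_mul_self (by rw [hXE.1, hX2])
    have h1 : IsUnit (1 - (-((1 / 2 : ℝ) • ((Z - X) * X)))) := by
      refine isUnit_one_sub_of_norm_lt_one ?_
      rw [norm_neg, norm_smul]
      have := norm_mul_le (Z - X) X
      have h2 : ‖Z - X‖ * ‖X‖ ≤ 1 * 1 := mul_le_mul hXZ.le hX1 (norm_nonneg _) zero_le_one
      norm_num
      linarith
    have h2 : g = (2 : ℝ) • (1 - (-((1 / 2 : ℝ) • ((Z - X) * X)))) := by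
      rw [sub_neg_eq_add, smul_add, smul_smul, sub_mul, hX2, two_smul, hg]
      norm_num
      rw [← one_add_one_eq_two]
      abel
    rw [h2]
    exact h1.smul (Units.mk0 (2 : ℝ) two_ne_zero)
  set h := gᴴ * g with hh
  have hhpos : h.PosDef := PosDef.conjTranspose_mul_self g (mulVec_injective_of_isUnit hgu)
  have hsp : ∀ x ∈ spectrum ℝ h, 0 < x := fun x hx =>
    hhpos.isStrictlyPositive.spectrum_pos hx
  have hhsa : IsSelfAdjoint h := hhpos.isHermitian
  let f : ℝ → ℝ := fun x => (√x)⁻¹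
  have hfc : ∀ f : ℝ → ℝ, ContinuousOn f (spectrum ℝ h) := fun f =>
    (finite_real_spectrum (A := h)).continuousOn f
  set s := cfc f h with hs
  have hsH : sᴴ = s := cfc_predicate f h
  have hsh : Commute s h := (Commute.refl h).cfc (hhsa.star_eq.symm ▸ Commute.refl h) f
  have hss : s * s * h = 1 := by
    have e1 : h = cfc (fun x : ℝ => x) h := (cfc_id' ℝ h).symm
    calc s * s * h = cfc (fun x => f x * f x * x) h := by
          rw [cfc_mul (fun x => f x * f x) (fun x => x) h (hfc _) (hfc _),
            cfc_mul f f h (hfc _) (hfc _), ← e1]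
      _ = cfc (fun _ => (1 : ℝ)) h := by
          refine cfc_congr fun x hx => ?_
          have := hsp x hx
          simp only [f]
          rw [← mul_inv, Real.mul_self_sqrt this.le, inv_mul_cancel₀ this.ne']
      _ = 1 := cfc_const_one ℝ h
  have hσh : σ h = h := by
    rw [hh, map_mul, map_conjTranspose, hg, map_add, map_one, map_mul, hZ.2, hXE.2]
  have hσs : σ s = s := by
    rw [hs, StarAlgHomClass.map_cfc (S := ℝ) σ f h (hfc f)
      (LinearMap.continuous_of_finiteDimensional (σ : Matrix N N ℂ →ₗ[ℝ] Matrix N N ℂ)) hhsa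
      (by rw [hσh]; exact hhsa), hσh]
  have hXh : Commute h X := by
    rw [hh, hgH, hg]
    have e1 : X * Z * Z * X = 1 := by rw [mul_assoc X, hZ2, mul_one, hX2]
    have e2 : (1 + X * Z) * (1 + Z * X) = 2 + X * Z + Z * X := by
      calc (1 + X * Z) * (1 + Z * X) = 1 + X * Z + Z * X + X * Z * Z * X := by noncomm_ring
        _ = 2 + X * Z + Z * X := by rw [e1, ← one_add_one_eq_two]; abel
    rw [e2]
    change (2 + X * Z + Z * X) * X = X * (2 + X * Z + Z * X)
    calc (2 + X * Z + Z * X) * X = 2 * X + X * Z * X + Z * (X * X) := by noncomm_ring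
      _ = 2 * X + X * Z * X + (X * X) * Z := by rw [hX2, mul_one, one_mul]
      _ = X * (2 + X * Z + Z * X) := by noncomm_ring
  have hXs : Commute s X := hXh.cfc (by rwa [hhsa.star_eq]) f
  have hZg : Z * g = g * X := by
    calc Z * g = Z + Z * Z * X := by rw [hg]; noncomm_ring
      _ = Z * (X * X) + X := by rw [hZ2, hX2, one_mul, mul_one]
      _ = g * X := by rw [hg]; noncomm_ring
  have huu : (g * s)ᴴ * (g * s) = 1 := by
    rw [conjTranspose_mul, hsH]
    calc s * gᴴ * (g * s) = s * (h * s) := by rw [hh]; noncomm_ring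
      _ = 1 := by rw [← hsh.eq, ← mul_assoc, hss]
  have huu' : (g * s) * (g * s)ᴴ = 1 := mul_eq_one_comm.mp huu
  refine ⟨g * s * v, ?_, ?_, ?_⟩
  · rw [conjTranspose_mul]
    calc vᴴ * (g * s)ᴴ * (g * s * v) = vᴴ * ((g * s)ᴴ * (g * s)) * v := by noncomm_ring
      _ = 1 := by rw [huu, mul_one, hv]
  · rw [map_mul, map_mul, hσs, hσv, hg, map_add, map_one, map_mul, hZ.2, hXE.2]
  · calc Z = Z * ((g * s) * (g * s)ᴴ) := by rw [huu', mul_one]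
      _ = (Z * g) * s * (g * s)ᴴ := by noncomm_ring
      _ = g * (X * s) * (g * s)ᴴ := by rw [hZg]; noncomm_ring
      _ = g * (s * X) * (g * s)ᴴ := by rw [hXs.eq]
      _ = g * s * v * K * (g * s * v)ᴴ := by
          rw [hXdef, conjTranspose_mul (g * s) v]; noncomm_ring

/-- A tripotent close to the orbit belongs to the orbit. -/
lemma mem_fixedUnitaryOrbit_of_infDist_le (hK : K ∈ fixedSelfAdjoint σ) (hK2 : K * K = 1)
    {Z : Matrix N N ℂ} (hZ : Z ∈ fixedSelfAdjoint σ) (hZ3 : Z * Z * Z = Z)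
    (hd : Metric.infDist Z (fixedUnitaryOrbit σ K) ≤ 1 / 4) : Z ∈ fixedUnitaryOrbit σ K := by
  have hne : (fixedUnitaryOrbit σ K).Nonempty := ⟨K, 1, by simp, map_one σ, by simp⟩
  obtain ⟨X, hX, hlt⟩ := (Metric.infDist_lt_iff hne).mp
    (hd.trans_lt (show (1 / 4 : ℝ) < 1 / 3 by norm_num))
  rw [dist_eq_norm] at hlt
  have hXE := fixedUnitaryOrbit_subset hK hX
  have hX2 := mul_self_of_mem_fixedUnitaryOrbit hK2 hX
  have hX1 : ‖X‖ ≤ 1 := norm_le_one_of_conjTranspose_mul_self (by rw [hXE.1, hX2])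
  refine mem_fixedUnitaryOrbit_of_norm_sub_lt hK hK2 hX hZ ?_ (by linarith)
  have h1 : ‖1 - Z * Z‖ < 1 := by
    have e : 1 - Z * Z = -(X * (Z - X) + (Z - X) * (Z - X) + (Z - X) * X) := by
      rw [← hX2]; noncomm_ring
    rw [e, norm_neg]
    have a1 := norm_mul_le X (Z - X)
    have a2 := norm_mul_le (Z - X) (Z - X)
    have a3 := norm_mul_le (Z - X) X
    have a4 := norm_add_le (X * (Z - X) + (Z - X) * (Z - X)) ((Z - X) * X)
    have a5 := norm_add_le (X * (Z - X)) ((Z - X) * (Z - X))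
    nlinarith [norm_nonneg (Z - X), norm_nonneg X]
  have h2 : IsUnit (1 - (1 - Z * Z)) := isUnit_one_sub_of_norm_lt_one h1
  have h3 : (1 - (1 - Z * Z)) * (1 - Z * Z) = 0 := by
    calc (1 - (1 - Z * Z)) * (1 - Z * Z) = Z * Z - Z * Z * Z * Z := by noncomm_ring
      _ = 0 := by rw [hZ3, sub_self]
  exact (sub_eq_zero.mp ((h2.mul_right_eq_zero).mp h3)).symm

end Orbit

section HairyBall

open scoped Matrix.Norms.L2Operator MatrixOrder ComplexOrder
open Topology

variable {N : Type*} [Fintype N]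

lemma eq_zero_of_trace_mul_self {W : Matrix N N ℂ} (hW : Wᴴ = W) (h : (W * W).trace = 0) :
    W = 0 := by
  rw [← trace_conjTranspose_mul_self_eq_zero_iff, hW, h]

lemma trace_mul_commutator_eq_zero {W Z : Matrix N N ℂ} (h : Commute W Z) (b : Matrix N N ℂ) :
    (W * (b * Z - Z * b)).trace = 0 := by
  rw [mul_sub, trace_sub, ← mul_assoc W b Z, trace_mul_comm (W * b) Z, ← mul_assoc, ← h.eq,
    mul_assoc, sub_self]

lemma re_trace_mul_self_nonneg {W : Matrix N N ℂ} (hW : Wᴴ = W) : 0 ≤ (W * W).trace.re := by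
  have := (posSemidef_conjTranspose_mul_self W).trace_nonneg
  rw [hW] at this
  exact (Complex.le_def.mp this).1

/-- The cubic term and the commutator term are orthogonal, so they vanish separately. -/
lemma tripotent_of_cubic_add_commutator_eq_zero {Z b : Matrix N N ℂ} (hZ : Zᴴ = Z)
    (h : Z * Z * Z - Z + (b * Z - Z * b) = 0) : Z * Z * Z = Z ∧ Commute b Z := by
  have hW : (Z * Z * Z - Z)ᴴ = Z * Z * Z - Z := by
    simp only [conjTranspose_sub, conjTranspose_mul, hZ, mul_assoc]
  have hc : Commute (Z * Z * Z - Z) Z :=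
    (((Commute.refl Z).mul_left (Commute.refl Z)).mul_left (Commute.refl Z)).sub_left
      (Commute.refl Z)
  have h0 : Z * Z * Z - Z = 0 := by
    refine eq_zero_of_trace_mul_self hW ?_
    have h1 := trace_mul_commutator_eq_zero hc b
    rw [show b * Z - Z * b = -(Z * Z * Z - Z) from (neg_eq_of_add_eq_zero_right h).symm, mul_neg,
      trace_neg, neg_eq_zero] at h1
    exact h1
  rw [h0, zero_add] at h
  exact ⟨sub_eq_zero.mp h0, sub_eq_zero.mp h⟩

lemma eq_zero_of_re_trace_mul_self {W : Matrix N N ℂ} (hW : Wᴴ = W)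
    (h : (W * W).trace.re = 0) : W = 0 := by
  have := (posSemidef_conjTranspose_mul_self W).trace_nonneg
  rw [hW] at this
  exact eq_zero_of_trace_mul_self hW (Complex.ext h (Complex.le_def.mp this).2.symm)

variable [DecidableEq N] {σ : Matrix N N ℂ →⋆ₐ[ℝ] Matrix N N ℂ} {K : Matrix N N ℂ}

/-- The real trace form on the self-adjoint matrices fixed by `σ`. -/
noncomputable def reTraceForm (σ : Matrix N N ℂ →⋆ₐ[ℝ] Matrix N N ℂ) :
    fixedSelfAdjoint σ →ₗ[ℝ] fixedSelfAdjoint σ →ₗ[ℝ] ℝ :=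
  LinearMap.mk₂ ℝ (fun Y Z => ((Y : Matrix N N ℂ) * (Z : Matrix N N ℂ)).trace.re)
    (fun a b c => by simp [add_mul]) (fun r a b => by simp)
    (fun a b c => by simp [mul_add]) (fun r a b => by simp)

lemma reTraceForm_apply (Y Z : fixedSelfAdjoint σ) :
    reTraceForm σ Y Z = ((Y : Matrix N N ℂ) * (Z : Matrix N N ℂ)).trace.re := rfl

/-- The linearization at an involution `X` commuting with `b` has positive determinant. -/
lemma det_linearization_pos {X b : Matrix N N ℂ} (hX : X ∈ fixedSelfAdjoint σ) (hX2 : X * X = 1)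
    (hbX : Commute b X)
    (hcent : ∀ Y Z : Matrix N N ℂ, Commute b Y → Commute b Z → Commute Y Z)
    (T : fixedSelfAdjoint σ →ₗ[ℝ] fixedSelfAdjoint σ)
    (hT : ∀ δ : fixedSelfAdjoint σ, (T δ : Matrix N N ℂ) =
      (δ : Matrix N N ℂ) + X * (δ : Matrix N N ℂ) * X +
      (b * (δ : Matrix N N ℂ) - (δ : Matrix N N ℂ) * b)) :
    0 < LinearMap.det T := by
  have hY : ∀ δ : fixedSelfAdjoint σ, ((δ : Matrix N N ℂ) + X * (δ : Matrix N N ℂ) * X)ᴴ =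
      (δ : Matrix N N ℂ) + X * (δ : Matrix N N ℂ) * X := by
    intro δ
    rw [conjTranspose_add, conjTranspose_mul, conjTranspose_mul, δ.2.1, hX.1, mul_assoc]
  have hB : ∀ δ : fixedSelfAdjoint σ, reTraceForm σ δ (T δ) =
      (((δ : Matrix N N ℂ) + X * δ * X) * (δ + X * δ * X)).trace.re / 2 := by
    intro δ
    rw [reTraceForm_apply, hT, mul_add, trace_add,
      trace_mul_commutator_eq_zero (Commute.refl _), add_zero]
    have h1 : (((δ : Matrix N N ℂ) + X * δ * X) * (δ + X * δ * X)).trace =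
        2 * ((δ : Matrix N N ℂ) * (δ + X * δ * X)).trace := by
      have e1 : (X * (δ : Matrix N N ℂ) * X * (X * δ * X)).trace =
          ((δ : Matrix N N ℂ) * δ).trace := by
        calc (X * (δ : Matrix N N ℂ) * X * (X * δ * X)).trace
            = (X * (δ * (X * X) * δ * X)).trace := by simp only [mul_assoc]
          _ = (δ * (X * X) * δ * X * X).trace := trace_mul_comm _ _
          _ = ((δ : Matrix N N ℂ) * δ).trace := by
            rw [mul_assoc _ X X, hX2, mul_one, mul_one]
      have e2 : (X * (δ : Matrix N N ℂ) * X * δ).trace = ((δ : Matrix N N ℂ) * (X * δ * X)).trace :=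
        trace_mul_comm _ _
      rw [add_mul, mul_add, mul_add, trace_add, trace_add, trace_add, e1, e2]
      ring
    rw [h1]
    simp
  refine LinearMap.det_pos_of_bilin_nonneg (reTraceForm σ) ?_ T ?_ ?_
  · intro δ hδ
    refine lt_of_le_of_ne (re_trace_mul_self_nonneg δ.2.1) fun h => hδ ?_
    exact Subtype.ext (eq_zero_of_re_trace_mul_self δ.2.1 h.symm)
  · intro δ
    rw [hB]
    exact div_nonneg (re_trace_mul_self_nonneg (hY δ)) zero_le_two
  · intro δ hδ
    have h1 := hB δ
    rw [hδ, map_zero] at h1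
    have h2 : (δ : Matrix N N ℂ) + X * δ * X = 0 :=
      eq_zero_of_re_trace_mul_self (hY δ) (by linarith)
    have h3 := hT δ
    rw [hδ, h2, zero_add, Submodule.coe_zero] at h3
    have h4 : Commute b (δ : Matrix N N ℂ) := sub_eq_zero.mp h3.symm
    have h5 : X * (δ : Matrix N N ℂ) * X = δ := by
      rw [(hcent _ _ hbX h4).eq, mul_assoc, hX2, mul_one]
    rw [h5, ← two_smul ℝ, smul_eq_zero] at h2
    exact Subtype.ext (h2.resolve_left two_ne_zero)

/-- The cubic vector field with a commutator perturbation. -/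
def cubicField (b : Matrix N N ℂ → Matrix N N ℂ) (Z : Matrix N N ℂ) : Matrix N N ℂ :=
  Z * Z * Z - Z + (b Z * Z - Z * b Z)

lemma cubicField_mem {b : Matrix N N ℂ → Matrix N N ℂ} {Z : Matrix N N ℂ}
    (hZ : Z ∈ fixedSelfAdjoint σ) (hb : b Z ∈ fixedSkewAdjoint σ) :
    cubicField b Z ∈ fixedSelfAdjoint σ := by
  refine ⟨?_, ?_⟩
  · simp only [cubicField, conjTranspose_sub, conjTranspose_add, conjTranspose_mul, hZ.1, hb.1]
    noncomm_ring
  · simp only [cubicField, map_sub, map_add, map_mul, hZ.2, hb.2]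

lemma contDiff_cubicField {b : Matrix N N ℂ → Matrix N N ℂ} (hb : ContDiff ℝ 2 b) :
    ContDiff ℝ 2 (cubicField b) := by
  unfold cubicField
  exact (((contDiff_id.mul contDiff_id).mul contDiff_id).sub contDiff_id).add
    ((hb.mul contDiff_id).sub (contDiff_id.mul hb))

/-- A tangent vector field on the orbit of an involution has a zero: the value of a continuous
map to skew-adjoint matrices commutes with the base point somewhere. -/
theorem exists_commute_of_continuous {C : Type*} [TopologicalSpace C] [CompactSpace C]
    {f : C → Matrix N N ℂ} (hf : Continuous f) (hinj : Function.Injective f)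
    (hrange : Set.range f = fixedUnitaryOrbit σ K) (hK : K ∈ fixedSelfAdjoint σ)
    (hK2 : K * K = 1) {b₀ : Matrix N N ℂ} (hb₀ : b₀ ∈ fixedSkewAdjoint σ) (hb₀K : Commute b₀ K)
    (hcent : ∀ Y Z : Matrix N N ℂ, Commute b₀ Y → Commute b₀ Z → Commute Y Z)
    {b : C → Matrix N N ℂ} (hb : Continuous b) (hbV : ∀ x, b x ∈ fixedSkewAdjoint σ) :
    ∃ x, Commute (b x) (f x) := by
  by_contra! hno
  have hKO : K ∈ fixedUnitaryOrbit σ K := ⟨1, by simp, map_one σ, by simp⟩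
  have hO1 : ∀ X ∈ fixedUnitaryOrbit σ K, ‖X‖ ≤ 1 := fun X hX =>
    norm_le_one_of_conjTranspose_mul_self (by
      rw [(fixedUnitaryOrbit_subset hK hX).1, mul_self_of_mem_fixedUnitaryOrbit hK2 hX])
  have hfO : ∀ x, f x ∈ fixedUnitaryOrbit σ K := fun x => hrange ▸ Set.mem_range_self x
  obtain ⟨ε, hε, hεb⟩ := exists_norm_lower_bound (isCompact_univ (X := C))
    (f := fun x => b x * f x - f x * b x) ((hb.mul hf).sub (hf.mul hb)).continuousOn
    (fun x _ h => hno x (sub_eq_zero.mp h))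
  obtain ⟨P, hP, hPb⟩ := exists_contDiff_approx hf hinj
    (b := fun x => (⟨b x, hbV x⟩ : fixedSkewAdjoint σ)) (hb.subtype_mk _)
    (show 0 < ε / 2 by positivity)
  have hPno : ∀ X ∈ fixedUnitaryOrbit σ K, ¬ Commute (P X : Matrix N N ℂ) X := by
    intro X hX hcomm
    rw [← hrange] at hX
    obtain ⟨x, rfl⟩ := hX
    have h1 := hεb x trivial
    have h2 : ‖(P (f x) : Matrix N N ℂ) - b x‖ < ε / 2 := hPb x
    have h3 : b x * f x - f x * b x = f x * (P (f x) - b x) - (P (f x) - b x) * f x := by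
      rw [mul_sub, sub_mul, hcomm.eq]; abel
    rw [h3] at h1
    have h4 := norm_sub_le (f x * (P (f x) - b x)) ((P (f x) - b x) * f x)
    have h5 := norm_mul_le (f x) ((P (f x) : Matrix N N ℂ) - b x)
    have h6 := norm_mul_le ((P (f x) : Matrix N N ℂ) - b x) (f x)
    have h7 := hO1 _ (hfO x)
    nlinarith [norm_nonneg ((P (f x) : Matrix N N ℂ) - b x), norm_nonneg (f x)]
  obtain ⟨π, hπ⟩ := LinearMap.exists_leftInverse_of_injective (fixedSelfAdjoint σ).subtype
    (Submodule.ker_subtype _)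
  have hπ' : ∀ Z (hZ : Z ∈ fixedSelfAdjoint σ), (π Z : Matrix N N ℂ) = Z := fun Z hZ =>
    congrArg Subtype.val (LinearMap.congr_fun hπ ⟨Z, hZ⟩)
  let πc : Matrix N N ℂ →L[ℝ] fixedSelfAdjoint σ := LinearMap.toContinuousLinearMap π
  let b₁ : Matrix N N ℂ → Matrix N N ℂ := fun Z => P Z
  have hb₁ : ContDiff ℝ 2 b₁ := (fixedSkewAdjoint σ).subtypeL.contDiff.comp hP
  have hb₀c : ContDiff ℝ 2 (fun _ : Matrix N N ℂ => b₀) := contDiff_const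
  have hsub : ContDiff ℝ 2 (fun Z : fixedSelfAdjoint σ => (Z : Matrix N N ℂ)) :=
    (fixedSelfAdjoint σ).subtypeL.contDiff
  let F₀ : fixedSelfAdjoint σ → fixedSelfAdjoint σ := fun Z => πc (cubicField (fun _ => b₀) Z)
  let F₁ : fixedSelfAdjoint σ → fixedSelfAdjoint σ := fun Z => πc (cubicField b₁ Z)
  have hF₀ : ∀ Z, (F₀ Z : Matrix N N ℂ) = cubicField (fun _ => b₀) Z := fun Z =>
    hπ' _ (cubicField_mem Z.2 hb₀)
  have hF₁ : ∀ Z, (F₁ Z : Matrix N N ℂ) = cubicField b₁ Z := fun Z =>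
    hπ' _ (cubicField_mem Z.2 (P _).2)
  have hF₀c : ContDiff ℝ 2 F₀ := πc.contDiff.comp ((contDiff_cubicField hb₀c).comp hsub)
  have hF₁c : ContDiff ℝ 2 F₁ := πc.contDiff.comp ((contDiff_cubicField hb₁).comp hsub)
  let U : Set (fixedSelfAdjoint σ) :=
    {Z | Metric.infDist (Z : Matrix N N ℂ) (fixedUnitaryOrbit σ K) < 1 / 4}
  have hdc : Continuous fun Z : fixedSelfAdjoint σ =>
      Metric.infDist (Z : Matrix N N ℂ) (fixedUnitaryOrbit σ K) :=
    (Metric.continuous_infDist_pt _).comp continuous_subtype_val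
  have hUo : IsOpen U := isOpen_lt hdc continuous_const
  have hOU : ∀ Z : fixedSelfAdjoint σ, (Z : Matrix N N ℂ) ∈ fixedUnitaryOrbit σ K → Z ∈ U := by
    intro Z hZ
    change Metric.infDist (Z : Matrix N N ℂ) (fixedUnitaryOrbit σ K) < 1 / 4
    rw [Metric.infDist_zero_of_mem hZ]
    norm_num
  have hUb : Bornology.IsBounded U := by
    refine isBounded_iff_forall_norm_le.mpr ⟨2, fun Z hZ => ?_⟩
    obtain ⟨X, hX, hlt⟩ := (Metric.infDist_lt_iff ⟨K, hKO⟩).mp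
      (show Metric.infDist (Z : Matrix N N ℂ) (fixedUnitaryOrbit σ K) < 1 / 4 from hZ)
    rw [dist_eq_norm] at hlt
    have h1 := norm_le_norm_add_norm_sub' (Z : Matrix N N ℂ) X
    have h2 := hO1 X hX
    rw [Submodule.coe_norm]
    linarith
  have hzero : ∀ Z ∈ closure U, ∀ c : Matrix N N ℂ,
      (Z : Matrix N N ℂ) * Z * Z - Z + (c * Z - Z * c) = 0 →
      (Z : Matrix N N ℂ) ∈ fixedUnitaryOrbit σ K ∧ Commute c (Z : Matrix N N ℂ) := by
    intro Z hZ c h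
    obtain ⟨h3, hc⟩ := tripotent_of_cubic_add_commutator_eq_zero Z.2.1 h
    refine ⟨mem_fixedUnitaryOrbit_of_infDist_le hK hK2 Z.2 h3 ?_, hc⟩
    exact closure_minimal (fun Z hZ => le_of_lt hZ)
      (isClosed_le hdc (continuous_const (y := (1 / 4 : ℝ)))) hZ
  have key : ∃ Z ∈ U, F₁ Z = 0 := by
    refine exists_zero_of_segment_ne_zero' hUo hUb hF₀c hF₁c ?_ ?_ ?_
    · intro t _ Z hZ h0
      have h := congrArg Subtype.val h0
      simp only [Submodule.coe_add, Submodule.coe_smul, Submodule.coe_sub, hF₀, hF₁,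
        Submodule.coe_zero] at h
      have h' : (Z : Matrix N N ℂ) * Z * Z - Z +
          ((b₀ + t • (b₁ Z - b₀)) * Z - Z * (b₀ + t • (b₁ Z - b₀))) = 0 := by
        rw [← h]
        simp only [cubicField, add_mul, mul_add, smul_mul_assoc, mul_smul_comm, sub_mul, mul_sub,
          smul_sub, smul_add]
        abel
      have hZU := hOU Z (hzero Z (frontier_subset_closure hZ) _ h').1
      rw [hUo.frontier_eq] at hZ
      exact hZ.2 hZU
    · intro X hXU hX0
      have h := congrArg Subtype.val hX0
      rw [hF₀] at h
      obtain ⟨hXO, hc⟩ := hzero X (subset_closure hXU) b₀ h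
      have hX2 := mul_self_of_mem_fixedUnitaryOrbit hK2 hXO
      refine det_linearization_pos X.2 hX2 hc hcent _ fun δ => ?_
      have hd : HasDerivAt (fun t : ℝ => F₀ (X + t • δ)) (fderiv ℝ F₀ X δ) 0 := by
        have h1 : HasDerivAt (fun t : ℝ => X + t • δ) δ 0 := by
          simpa using ((hasDerivAt_id (0 : ℝ)).smul_const δ).const_add X
        have h2 : HasFDerivAt F₀ (fderiv ℝ F₀ X) (X + (0 : ℝ) • δ) := by
          rw [zero_smul, add_zero]
          exact (hF₀c.differentiable (by norm_num) X).hasFDerivAt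
        exact h2.comp_hasDerivAt (0 : ℝ) h1
      have hd' : HasDerivAt (fun t : ℝ => (F₀ (X + t • δ) : Matrix N N ℂ))
          (fderiv ℝ F₀ X δ : Matrix N N ℂ) 0 :=
        (fixedSelfAdjoint σ).subtypeL.hasFDerivAt.comp_hasDerivAt (0 : ℝ) hd
      have hz : HasDerivAt (fun t : ℝ => (X : Matrix N N ℂ) + t • (δ : Matrix N N ℂ)) δ 0 := by
        simpa using ((hasDerivAt_id (0 : ℝ)).smul_const (δ : Matrix N N ℂ)).const_add
          (X : Matrix N N ℂ)
      have he := (((hz.mul hz).mul hz).sub hz).add ((hz.const_mul b₀).sub (hz.mul_const b₀))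
      have := hd'.unique (he.congr_of_eventuallyEq (Filter.Eventually.of_forall fun t => hF₀ _))
      refine this.trans ?_
      simp only [Pi.mul_apply, zero_smul, add_zero]
      rw [hX2, add_mul, mul_assoc (δ : Matrix N N ℂ) X X, hX2]
      noncomm_ring
    · refine ⟨⟨K, hK⟩, hOU _ hKO, Subtype.ext ?_⟩
      rw [hF₀]
      simp [cubicField, hK2, hb₀K.eq]
  obtain ⟨Z, hZU, hZ0⟩ := key
  have h := congrArg Subtype.val hZ0
  rw [hF₁] at h
  obtain ⟨hZO, hc⟩ := hzero Z (subset_closure hZU) (b₁ Z) h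
  exact hPno _ hZO hc

end HairyBall

section Averaging

open Topology
open scoped ComplexOrder

/-- A cocompact action on a locally compact space has a compact set meeting every orbit. -/
lemma exists_isCompact_forall_exists_smul_mem (Γ : Type*) {Y : Type*} [Group Γ] [MulAction Γ Y]
    [TopologicalSpace Y] [ContinuousConstSMul Γ Y] [LocallyCompactSpace Y]
    [CompactSpace (MulAction.orbitRel.Quotient Γ Y)] :
    ∃ D : Set Y, IsCompact D ∧ ∀ y : Y, ∃ γ : Γ, γ • y ∈ D := by
  let mk : Y → MulAction.orbitRel.Quotient Γ Y := Quotient.mk _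
  have hopen : IsOpenMap mk := isOpenMap_quotient_mk'_mul
  choose k hk hkn using fun y : Y => exists_compact_mem_nhds y
  obtain ⟨t, ht⟩ := isCompact_univ.elim_finite_subcover (fun y => mk '' interior (k y))
    (fun y => hopen _ isOpen_interior) (by
      intro z _
      obtain ⟨y, rfl⟩ := Quotient.exists_rep z
      exact Set.mem_iUnion.2 ⟨y, y, mem_interior_iff_mem_nhds.2 (hkn y), rfl⟩)
  refine ⟨⋃ y ∈ t, k y, t.isCompact_biUnion fun y _ => hk y, fun y => ?_⟩
  obtain ⟨x, hx, z, hz, hzy⟩ := Set.mem_iUnion₂.1 (ht (Set.mem_univ (mk y)))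
  obtain ⟨γ, hγ⟩ := (MulAction.orbitRel_apply.1 (Quotient.exact hzy))
  exact ⟨γ, Set.mem_iUnion₂.2 ⟨x, hx, by
    have h : γ • y = z := hγ
    rw [h]; exact interior_subset hz⟩⟩

/-- Averaging: a continuous positive definite equivariant matrix-valued function exists for every
proper cocompact action and every linear representation. -/
lemma exists_equivariant_posDef {Γ Y N : Type*} [Group Γ] [MulAction Γ Y] [TopologicalSpace Y]
    [T2Space Y] [LocallyCompactSpace Y] [ContinuousConstSMul Γ Y] [ProperlyDiscontinuousSMul Γ Y]
    [Fintype N] [DecidableEq N] {D : Set Y} (hD : IsCompact D)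
    (hcov : ∀ y : Y, ∃ γ : Γ, γ • y ∈ D) (ρ : Γ →* Matrix N N ℂ) :
    ∃ A : Y → Matrix N N ℂ, Continuous A ∧ (∀ y, (A y).PosDef) ∧
      ∀ (γ : Γ) y, A (γ • y) = ρ γ * A y * (ρ γ)ᴴ := by
  obtain ⟨φ, hφ1, -, hφc, hφ⟩ := exists_continuous_one_zero_of_isCompact hD isClosed_empty
    (Set.disjoint_empty D)
  let F : Γ → Y → Matrix N N ℂ := fun γ y => (φ (γ⁻¹ • y) : ℂ) • (ρ γ * (ρ γ)ᴴ)
  have hfin : ∀ W : Set Y, IsCompact W →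
      {γ : Γ | (Function.support (F γ) ∩ W).Nonempty}.Finite := by
    intro W hW
    refine (ProperlyDiscontinuousSMul.finite_disjoint_inter_image (Γ := Γ)
      (hφc : IsCompact (tsupport φ)) hW).subset ?_
    rintro γ ⟨y, hy, hyW⟩
    refine ⟨y, ⟨γ⁻¹ • y, subset_tsupport _ ?_, smul_inv_smul γ y⟩, hyW⟩
    intro h0
    exact hy (by simp [F, h0])
  have hfin' : ∀ y, (Function.support fun γ => F γ y).Finite := fun y =>
    (hfin {y} isCompact_singleton).subset fun γ hγ => ⟨y, hγ, rfl⟩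
  have hFpos : ∀ γ y, (F γ y).PosSemidef := fun γ y =>
    (posSemidef_self_mul_conjTranspose (ρ γ)).smul (by exact_mod_cast (hφ _).1)
  refine ⟨fun y => ∑ᶠ γ, F γ y, ?_, ?_, ?_⟩
  · refine continuous_finsum (fun γ => ?_) fun y => ?_
    · exact (Complex.continuous_ofReal.comp
        (φ.continuous.comp (continuous_const_smul γ⁻¹))).smul continuous_const
    · obtain ⟨W, hW, hWy⟩ := exists_compact_mem_nhds y
      exact ⟨W, hWy, hfin W hW⟩
  · intro y
    obtain ⟨γ, hγ⟩ := hcov y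
    have h1 : (F γ⁻¹ y).PosDef := by
      simp only [F, inv_inv]
      rw [hφ1 hγ, Pi.one_apply, Complex.ofReal_one, one_smul]
      refine PosDef.mul_conjTranspose_self _ (vecMul_injective_of_isUnit ?_)
      exact (Group.isUnit γ⁻¹).map ρ
    classical
    have h2 : (∑ᶠ γ, F γ y) = ∑ γ ∈ insert γ⁻¹ (hfin' y).toFinset, F γ y :=
      finsum_eq_sum_of_support_subset _ fun γ' hγ' => by
        simp only [Finset.coe_insert, Set.Finite.coe_toFinset]
        exact Set.mem_insert_of_mem _ hγ'
    change (∑ᶠ γ, F γ y).PosDef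
    rw [h2, ← Finset.add_sum_erase _ _ (Finset.mem_insert_self _ _)]
    exact h1.add_posSemidef (posSemidef_sum _ fun γ' _ => hFpos γ' y)
  · intro γ y
    let L : Matrix N N ℂ →+ Matrix N N ℂ :=
      ((AddMonoidHom.mulLeft (ρ γ)).comp (AddMonoidHom.mulRight ((ρ γ)ᴴ)))
    have hL : ∀ M, L M = ρ γ * M * (ρ γ)ᴴ := fun M => by simp [L, mul_assoc]
    change (∑ᶠ γ', F γ' (γ • y)) = ρ γ * (∑ᶠ γ', F γ' y) * (ρ γ)ᴴ
    rw [← hL, L.map_finsum (hfin' y), ← finsum_comp_equiv (Equiv.mulLeft γ)]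
    refine finsum_congr fun γ' => ?_
    rw [hL]
    simp only [F, Equiv.coe_mulLeft, _root_.mul_inv_rev, map_mul, conjTranspose_mul, mul_smul_comm,
      smul_mul_assoc, mul_smul, inv_smul_smul, mul_assoc]

end Averaging

section TraceBound

open scoped ComplexOrder MatrixOrder

variable {N : Type*} [Fintype N] [DecidableEq N]

/-- The `X`-symmetrization `A + X σ(A) X` of a matrix `A`. -/
def symmetrization (σ : Matrix N N ℂ →⋆ₐ[ℝ] Matrix N N ℂ) (A X : Matrix N N ℂ) : Matrix N N ℂ :=
  A + X * σ A * X

lemma posSemidef_map {A : Matrix N N ℂ} (σ : Matrix N N ℂ →⋆ₐ[ℝ] Matrix N N ℂ)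
    (hA : A.PosSemidef) : (σ A).PosSemidef := by
  obtain ⟨B, rfl⟩ := CStarAlgebra.nonneg_iff_eq_star_mul_self.1 hA.nonneg
  rw [map_mul, map_star]
  exact posSemidef_conjTranspose_mul_self _

lemma posDef_symmetrization {A X : Matrix N N ℂ} (σ : Matrix N N ℂ →⋆ₐ[ℝ] Matrix N N ℂ)
    (hA : A.PosDef) (hX : Xᴴ = X) : (symmetrization σ A X).PosDef := by
  have h := (posSemidef_map σ hA.posSemidef).mul_mul_conjTranspose_same X
  rw [hX] at h
  exact hA.add_posSemidef h

lemma symmetrization_congr {A X a : Matrix N N ℂ} {σ : Matrix N N ℂ →⋆ₐ[ℝ] Matrix N N ℂ}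
    (ha : aᴴ * σ a = 1) :
    symmetrization σ (a * A * aᴴ) (a * X * aᴴ) = a * symmetrization σ A X * aᴴ := by
  have ha' : (σ a)ᴴ * a = 1 := by
    simpa [conjTranspose_mul] using congrArg conjTranspose ha
  have h : a * X * aᴴ * σ (a * A * aᴴ) * (a * X * aᴴ) =
      a * X * (aᴴ * σ a) * σ A * ((σ a)ᴴ * a) * X * aᴴ := by
    rw [map_mul, map_mul, map_conjTranspose]
    simp only [mul_assoc]
  rw [symmetrization, h, ha, ha', symmetrization, mul_add, add_mul]
  simp only [mul_one, mul_assoc]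

/-- If `A - σ(A)` commutes with the involution `X`, then the size of `a` is controlled by the
symmetrization of the transported pair `(aAa*, aXa*)`. -/
lemma two_mul_trace_le {A X a : Matrix N N ℂ} {σ : Matrix N N ℂ →⋆ₐ[ℝ] Matrix N N ℂ}
    (hA : A.PosDef) (hX : Xᴴ = X) (hX2 : X * X = 1) (hc : Commute (A - σ A) X)
    (ha : aᴴ * σ a = 1) {S Z : Matrix N N ℂ} (hZ : Z = a * X * aᴴ)
    (hS : S = symmetrization σ (a * A * aᴴ) Z) :
    2 * (a * aᴴ).trace.re ≤ (S.trace + (Z * S⁻¹ * Z).trace).re := by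
  have hT := posDef_symmetrization σ hA hX
  set T := symmetrization σ A X with hTdef
  have hTu : IsUnit T.det := (isUnit_iff_isUnit_det T).1 hT.isUnit
  have hTX : Commute T X := by
    have h := hc.eq
    rw [sub_mul, mul_sub] at h
    change (A + X * σ A * X) * X = X * (A + X * σ A * X)
    have h1 : X * σ A * X * X = X * σ A := by rw [mul_assoc, hX2, mul_one]
    have h2 : X * (X * σ A * X) = σ A * X := by rw [← mul_assoc, ← mul_assoc, hX2, one_mul]
    rw [add_mul, mul_add, h1, h2]
    rw [sub_eq_iff_eq_add.1 h]
    abel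
  have hS' : S = a * T * aᴴ := by rw [hS, hZ, symmetrization_congr ha]
  have hau : IsUnit a.det := by
    have h : a * (σ a)ᴴ = 1 := mul_eq_one_comm.1 (by
      simpa [conjTranspose_mul] using congrArg conjTranspose ha)
    exact isUnit_det_of_right_inverse h
  have hau' : IsUnit aᴴ.det := isUnit_det_of_right_inverse ha
  have hTiX : X * T⁻¹ * X = T⁻¹ := by
    have h : T * (X * T⁻¹ * X) = 1 := by
      rw [← mul_assoc, ← mul_assoc, hTX.eq, mul_assoc X, mul_nonsing_inv _ hTu, mul_one, hX2]
    exact (inv_eq_right_inv h).symm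
  have hZS : Z * S⁻¹ * Z = a * T⁻¹ * aᴴ := by
    rw [hZ, hS', Matrix.mul_inv_rev, Matrix.mul_inv_rev]
    calc a * X * aᴴ * (aᴴ⁻¹ * (T⁻¹ * a⁻¹)) * (a * X * aᴴ)
        = a * (X * (aᴴ * aᴴ⁻¹) * T⁻¹ * (a⁻¹ * a) * X) * aᴴ := by simp only [mul_assoc]
      _ = a * T⁻¹ * aᴴ := by
        rw [mul_nonsing_inv _ hau', nonsing_inv_mul _ hau, mul_one, mul_one, hTiX]
  have hpos : (a * (T + T⁻¹ - 2) * aᴴ).PosSemidef := by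
    have h := (hT.inv.posSemidef.mul_mul_conjTranspose_same (1 - T)).mul_mul_conjTranspose_same a
    have h1 : (1 - T) * T⁻¹ * (1 - T)ᴴ = T + T⁻¹ - 2 := by
      rw [conjTranspose_sub, hT.isHermitian.eq, conjTranspose_one, sub_mul, one_mul,
        mul_nonsing_inv _ hTu, mul_sub, mul_one, sub_mul, one_mul, nonsing_inv_mul _ hTu,
        ← one_add_one_eq_two]
      abel
    rwa [h1] at h
  have htr := (Complex.le_def.1 hpos.trace_nonneg).1
  rw [hZS, hS', ← trace_add, ← add_mul, ← mul_add]
  have h2 : a * (T + T⁻¹ - 2) * aᴴ = a * (T + T⁻¹) * aᴴ - (a * aᴴ + a * aᴴ) := by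
    rw [mul_sub, sub_mul, ← one_add_one_eq_two, mul_add a 1 1, mul_one, add_mul]
  rw [h2, trace_sub, trace_add, Complex.sub_re, Complex.add_re, Complex.zero_re] at htr
  linarith

end TraceBound

section QuaternionicStructure

variable (p q : ℕ)

lemma OmegaC_transpose : (OmegaC p q)ᵀ = -OmegaC p q := by
  simp [OmegaC, fromBlocks_transpose, fromBlocks_neg]

lemma OmegaC_mul_self : OmegaC p q * OmegaC p q = -1 := by
  rw [OmegaC, fromBlocks_multiply]
  ext (i | i) (j | j) <;> simp [one_apply]

lemma OmegaC_map_conj : (OmegaC p q).map (starRingEnd ℂ) = OmegaC p q := by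
  rw [OmegaC, fromBlocks_map]
  congr 1 <;> ext i j <;> simp [one_apply, apply_ite]

lemma neg_OmegaC_mul_OmegaC : -OmegaC p q * OmegaC p q = 1 := by
  rw [neg_mul, OmegaC_mul_self, neg_neg]

lemma OmegaC_mul_neg_OmegaC : OmegaC p q * -OmegaC p q = 1 := by
  rw [mul_neg, OmegaC_mul_self, neg_neg]

/-- The conjugation `Z ↦ Ω Z̄ Ω⁻¹` whose fixed points are the quaternionic matrices. -/
def quaternionicConj :
    Matrix (SpIdx p q) (SpIdx p q) ℂ →⋆ₐ[ℝ] Matrix (SpIdx p q) (SpIdx p q) ℂ where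
  toFun Z := OmegaC p q * Z.map (starRingEnd ℂ) * -OmegaC p q
  map_one' := by
    rw [Matrix.map_one _ (map_zero _) (map_one _), mul_one, OmegaC_mul_neg_OmegaC]
  map_mul' Z W := by
    rw [Matrix.map_mul]
    calc _ = OmegaC p q * Z.map (starRingEnd ℂ) * (-OmegaC p q * OmegaC p q) *
        W.map (starRingEnd ℂ) * -OmegaC p q := by
          rw [neg_OmegaC_mul_OmegaC, mul_one]
          simp only [mul_assoc]
      _ = _ := by simp only [mul_assoc]
  map_zero' := by rw [Matrix.map_zero _ (map_zero _), mul_zero, zero_mul]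
  map_add' Z W := by rw [Matrix.map_add _ (map_add _), mul_add, add_mul]
  commutes' r := by
    have h : (algebraMap ℝ (Matrix (SpIdx p q) (SpIdx p q) ℂ) r).map (starRingEnd ℂ) =
        algebraMap ℝ _ r := by
      ext i j
      by_cases hij : i = j <;> simp [algebraMap_matrix_apply, hij]
    rw [h, ← Algebra.commutes, mul_assoc, OmegaC_mul_neg_OmegaC, mul_one]
  map_star' Z := by
    have h : (OmegaC p q)ᴴ = -OmegaC p q := by
      have := congrArg transpose (OmegaC_map_conj p q)
      rw [OmegaC_transpose] at this
      exact this
    have h' : (Zᴴ).map (starRingEnd ℂ) = (Z.map (starRingEnd ℂ))ᴴ := rfl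
    rw [star_eq_conjTranspose, star_eq_conjTranspose, h', conjTranspose_mul, conjTranspose_mul,
      conjTranspose_neg, h, neg_neg, mul_assoc]

variable {p q}

lemma quaternionicConj_apply (Z : Matrix (SpIdx p q) (SpIdx p q) ℂ) :
    quaternionicConj p q Z = OmegaC p q * Z.map (starRingEnd ℂ) * -OmegaC p q := rfl

lemma quaternionicConj_quaternionicConj (Z : Matrix (SpIdx p q) (SpIdx p q) ℂ) :
    quaternionicConj p q (quaternionicConj p q Z) = Z := by
  have h : (-OmegaC p q).map (starRingEnd ℂ) = -OmegaC p q := by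
    rw [Matrix.map_neg _ (map_neg _), OmegaC_map_conj]
  have h' : (Z.map (starRingEnd ℂ)).map (starRingEnd ℂ) = Z := by ext; simp
  rw [quaternionicConj_apply, quaternionicConj_apply, Matrix.map_mul, Matrix.map_mul,
    OmegaC_map_conj, h, h']
  calc _ = (OmegaC p q * OmegaC p q) * Z * (-OmegaC p q * -OmegaC p q) := by
        simp only [mul_assoc]
    _ = Z := by rw [neg_mul_neg, OmegaC_mul_self, neg_one_mul, neg_mul_neg, mul_one]

lemma quaternionicConj_smul (c : ℂ) (Z : Matrix (SpIdx p q) (SpIdx p q) ℂ) :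
    quaternionicConj p q (c • Z) = starRingEnd ℂ c • quaternionicConj p q Z := by
  rw [quaternionicConj_apply, quaternionicConj_apply, Matrix.map_smul' _ _ _ (map_mul _),
    mul_smul_comm, smul_mul_assoc]

lemma conjTranspose_mul_quaternionicConj {g : Matrix (SpIdx p q) (SpIdx p q) ℂ} :
    gᴴ * quaternionicConj p q g = 1 ↔ gᵀ * OmegaC p q * g = OmegaC p q := by
  have h : gᴴ * quaternionicConj p q g =
      (gᵀ * OmegaC p q * g).map (starRingEnd ℂ) * -OmegaC p q := by
    rw [quaternionicConj_apply, Matrix.map_mul, Matrix.map_mul, OmegaC_map_conj]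
    change (gᵀ).map (starRingEnd ℂ) * _ = _
    simp only [mul_assoc]
  rw [h]
  constructor
  · intro h1
    have h2 : (gᵀ * OmegaC p q * g).map (starRingEnd ℂ) = OmegaC p q := by
      calc _ = (gᵀ * OmegaC p q * g).map (starRingEnd ℂ) * (-OmegaC p q * OmegaC p q) := by
            rw [neg_OmegaC_mul_OmegaC, mul_one]
        _ = OmegaC p q := by rw [← mul_assoc, h1, one_mul]
    refine Matrix.map_injective (starRingEnd ℂ).injective ?_
    simp only [h2, OmegaC_map_conj]
  · intro h1
    rw [h1, OmegaC_map_conj, OmegaC_mul_neg_OmegaC]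

lemma Kpq_conjTranspose : (Kpq p q)ᴴ = Kpq p q := by
  rw [Kpq, diagonal_conjTranspose]
  congr 1
  ext i
  rcases i with (i | i) | (i | i) <;> simp

lemma Kpq_mul_self : Kpq p q * Kpq p q = 1 := by
  rw [Kpq, diagonal_mul_diagonal, ← diagonal_one]
  congr 1
  ext i
  rcases i with (i | i) | (i | i) <;> simp

lemma quaternionicConj_diagonal (d e : Fin p ⊕ Fin q → ℂ) :
    quaternionicConj p q (diagonal (Sum.elim d e)) =
      diagonal (Sum.elim (starRingEnd _ e) (starRingEnd _ d)) := by
  rw [quaternionicConj_apply, OmegaC, diagonal_map (map_zero _)]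
  have h (u v : Fin p ⊕ Fin q → ℂ) :
      diagonal (Sum.elim u v) = fromBlocks (diagonal u) 0 0 (diagonal v) :=
    (fromBlocks_diagonal u v).symm
  have h' : (starRingEnd ℂ ∘ Sum.elim d e) = Sum.elim (starRingEnd _ d) (starRingEnd _ e) := by
    ext i
    rcases i with i | i <;> rfl
  simp only [Function.comp_def] at h' ⊢
  rw [h', h, h, fromBlocks_multiply, fromBlocks_neg, fromBlocks_multiply]
  simp

lemma Kpq_mem : Kpq p q ∈ fixedSelfAdjoint (quaternionicConj p q) := by
  refine ⟨Kpq_conjTranspose, ?_⟩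
  rw [Kpq, quaternionicConj_diagonal]
  congr 2 <;> ext i <;> rcases i with i | i <;> simp

/-- A regular element of the diagonal Cartan subalgebra. -/
def regularDiagonal (p q : ℕ) : Matrix (SpIdx p q) (SpIdx p q) ℂ :=
  diagonal (Sum.elim (fun k => Complex.I * (Fintype.equivFin (Fin p ⊕ Fin q) k + 1 : ℕ))
    (fun k => -(Complex.I * (Fintype.equivFin (Fin p ⊕ Fin q) k + 1 : ℕ))))

lemma regularDiagonal_mem : regularDiagonal p q ∈ fixedSkewAdjoint (quaternionicConj p q) := by
  constructor
  · rw [regularDiagonal, diagonal_conjTranspose, diagonal_neg]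
    congr 1
    ext i
    rcases i with i | i <;> simp
  · rw [regularDiagonal, quaternionicConj_diagonal]
    congr 2 <;> ext i <;> simp

lemma commute_regularDiagonal_Kpq : Commute (regularDiagonal p q) (Kpq p q) :=
  commute_diagonal _ _

lemma isDiag_of_commute_diagonal {N : Type*} [Fintype N] [DecidableEq N] {d : N → ℂ}
    (hd : Function.Injective d) {Y : Matrix N N ℂ} (h : Commute (diagonal d) Y) : Y.IsDiag := by
  intro i j hij
  have h1 := congrFun (congrFun h.eq i) j
  rw [diagonal_mul, mul_diagonal, mul_comm, ← sub_eq_zero, ← mul_sub] at h1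
  exact (mul_eq_zero.1 h1).resolve_right (sub_ne_zero.2 (hd.ne hij))

lemma regularDiagonal_centralizer {Y Z : Matrix (SpIdx p q) (SpIdx p q) ℂ}
    (hY : Commute (regularDiagonal p q) Y) (hZ : Commute (regularDiagonal p q) Z) :
    Commute Y Z := by
  have hd : Function.Injective (Sum.elim
      (fun k => Complex.I * (Fintype.equivFin (Fin p ⊕ Fin q) k + 1 : ℕ))
      (fun k => -(Complex.I * (Fintype.equivFin (Fin p ⊕ Fin q) k + 1 : ℕ)))) := by
    refine Function.Injective.sumElim ?_ ?_ ?_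
    · intro a b h
      have := mul_left_cancel₀ Complex.I_ne_zero h
      have : (Fintype.equivFin (Fin p ⊕ Fin q) a : ℕ) = Fintype.equivFin (Fin p ⊕ Fin q) b := by
        have := Nat.cast_injective this
        omega
      exact (Fintype.equivFin _).injective (Fin.ext this)
    · intro a b h
      have := mul_left_cancel₀ Complex.I_ne_zero (neg_injective h)
      have : (Fintype.equivFin (Fin p ⊕ Fin q) a : ℕ) = Fintype.equivFin (Fin p ⊕ Fin q) b := by
        have := Nat.cast_injective this
        omega
      exact (Fintype.equivFin _).injective (Fin.ext this)
    · intro a b h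
      have h1 := congrArg Complex.im h
      simp at h1
      have : (0 : ℝ) ≤ (Fintype.equivFin (Fin p ⊕ Fin q) a : ℕ) := Nat.cast_nonneg _
      have : (0 : ℝ) ≤ (Fintype.equivFin (Fin p ⊕ Fin q) b : ℕ) := Nat.cast_nonneg _
      linarith
  rw [← (isDiag_of_commute_diagonal hd hY).diagonal_diag,
    ← (isDiag_of_commute_diagonal hd hZ).diagonal_diag]
  exact commute_diagonal _ _

end QuaternionicStructure

section SymplecticTopology

variable {p q : ℕ}

/-- The underlying matrix of an element of the symplectic group. -/
def spVal (g : SpC p q) : Matrix (SpIdx p q) (SpIdx p q) ℂ := g.val.val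

lemma spVal_mul (g h : SpC p q) : spVal (g * h) = spVal g * spVal h := rfl

lemma spVal_one : spVal (1 : SpC p q) = 1 := rfl

lemma spVal_injective : Function.Injective (spVal (p := p) (q := q)) :=
  fun _ _ h => Subtype.ext (Units.ext h)

lemma spVal_inv_mul (g : SpC p q) : spVal g⁻¹ * spVal g = 1 := by
  rw [← spVal_mul, inv_mul_cancel, spVal_one]

lemma spVal_mul_inv (g : SpC p q) : spVal g * spVal g⁻¹ = 1 := by
  rw [← spVal_mul, mul_inv_cancel, spVal_one]

lemma symplectic_inv_left {A : Matrix (SpIdx p q) (SpIdx p q) ℂ}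
    (hA : Aᵀ * OmegaC p q * A = OmegaC p q) : (-OmegaC p q * Aᵀ * OmegaC p q) * A = 1 := by
  rw [mul_assoc, mul_assoc, ← mul_assoc (Aᵀ), hA, neg_OmegaC_mul_OmegaC]

/-- The element of the symplectic group with given matrix. -/
def spMk (A : Matrix (SpIdx p q) (SpIdx p q) ℂ) (hA : Aᵀ * OmegaC p q * A = OmegaC p q) :
    SpC p q :=
  ⟨⟨A, -OmegaC p q * Aᵀ * OmegaC p q, mul_eq_one_comm.1 (symplectic_inv_left hA),
    symplectic_inv_left hA⟩, hA⟩

lemma spVal_spMk {A : Matrix (SpIdx p q) (SpIdx p q) ℂ} (hA : Aᵀ * OmegaC p q * A = OmegaC p q) :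
    spVal (spMk A hA) = A := rfl

lemma continuous_spVal : Continuous (spVal (p := p) (q := q)) :=
  Units.continuous_val.comp continuous_subtype_val

lemma isClosedEmbedding_spVal : Topology.IsClosedEmbedding (spVal (p := p) (q := q)) := by
  let S : Set (Matrix (SpIdx p q) (SpIdx p q) ℂ) := {A | Aᵀ * OmegaC p q * A = OmegaC p q}
  have hS : IsClosed S := isClosed_eq (by fun_prop) continuous_const
  let e : SpC p q ≃ₜ S :=
    { toFun := fun g => ⟨spVal g, g.2⟩
      invFun := fun A => spMk A.1 A.2
      left_inv := fun g => spVal_injective rfl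
      right_inv := fun A => rfl
      continuous_toFun := continuous_spVal.subtype_mk _
      continuous_invFun := by
        refine Continuous.subtype_mk (Units.continuous_iff.2 ⟨continuous_subtype_val, ?_⟩) _
        change Continuous fun A : S => -OmegaC p q * A.1ᵀ * OmegaC p q
        fun_prop }
  exact hS.isClosedEmbedding_subtypeVal.comp e.isClosedEmbedding

instance : LocallyCompactSpace (SpC p q) :=
  have : LocallyCompactSpace (Matrix (SpIdx p q) (SpIdx p q) ℂ) :=
    inferInstanceAs (LocallyCompactSpace (SpIdx p q → SpIdx p q → ℂ))
  isClosedEmbedding_spVal.locallyCompactSpace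

lemma isCompact_setOf_forall_norm_le (R : ℝ) :
    IsCompact {g : SpC p q | ∀ i j, ‖spVal g i j‖ ≤ R} := by
  have h : IsCompact {A : Matrix (SpIdx p q) (SpIdx p q) ℂ | ∀ i j, ‖A i j‖ ≤ R} := by
    have h1 := isCompact_univ_pi fun _ : SpIdx p q => isCompact_univ_pi fun _ : SpIdx p q =>
      ProperSpace.isCompact_closedBall (0 : ℂ) R
    have h2 : {A : Matrix (SpIdx p q) (SpIdx p q) ℂ | ∀ i j, ‖A i j‖ ≤ R} =
        Set.univ.pi fun _ => Set.univ.pi fun _ => Metric.closedBall (0 : ℂ) R := by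
      ext A
      exact ⟨fun h i _ j _ => mem_closedBall_zero_iff.2 (h i j),
        fun h i j => mem_closedBall_zero_iff.1 (h i trivial j trivial)⟩
    exact h2 ▸ h1
  exact isClosedEmbedding_spVal.isCompact_preimage h

lemma norm_sq_le_trace {N : Type*} [Fintype N] (A : Matrix N N ℂ) (i j : N) :
    ‖A i j‖ ^ 2 ≤ (A * Aᴴ).trace.re := by
  have h : (A * Aᴴ).trace.re = ∑ i, ∑ j, ‖A i j‖ ^ 2 := by
    simp only [trace, diag_apply, mul_apply, conjTranspose_apply, Complex.re_sum]
    refine Finset.sum_congr rfl fun i _ => Finset.sum_congr rfl fun j _ => ?_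
    rw [← Complex.normSq_eq_norm_sq, Complex.star_def, Complex.mul_conj, Complex.ofReal_re]
  rw [h]
  exact (Finset.single_le_sum (f := fun j => ‖A i j‖ ^ 2) (fun _ _ => sq_nonneg _)
    (Finset.mem_univ j)).trans (Finset.single_le_sum (f := fun i => ∑ j, ‖A i j‖ ^ 2)
      (fun _ _ => Finset.sum_nonneg fun _ _ => sq_nonneg _) (Finset.mem_univ i))

lemma isCompact_setOf_trace_le (R : ℝ) :
    IsCompact {g : SpC p q | (spVal g * (spVal g)ᴴ).trace.re ≤ R} := by
  refine (isCompact_setOf_forall_norm_le (√R)).of_isClosed_subset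
    (isClosed_le ?_ continuous_const) fun g hg i j => ?_
  · have := continuous_spVal (p := p) (q := q)
    fun_prop
  · exact Real.le_sqrt_of_sq_le ((norm_sq_le_trace _ i j).trans hg)

lemma isCompact_setOf_unitary : IsCompact {g : SpC p q | (spVal g)ᴴ * spVal g = 1} := by
  refine (isCompact_setOf_trace_le
    (1 : Matrix (SpIdx p q) (SpIdx p q) ℂ).trace.re).of_isClosed_subset
    (isClosed_eq ?_ continuous_const) fun g hg => ?_
  · have := continuous_spVal (p := p) (q := q)
    fun_prop
  · rw [Set.mem_ofPred_eq, mul_eq_one_comm.1 hg]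

lemma mem_SpPQ_iff {h : SpC p q} : h ∈ SpPQ p q ↔ spVal h * Kpq p q * (spVal h)ᴴ = Kpq p q := by
  change (spVal h)ᴴ * Kpq p q * spVal h = Kpq p q ↔ _
  have key : ∀ A B : Matrix (SpIdx p q) (SpIdx p q) ℂ,
      A * Kpq p q * B = Kpq p q → B * Kpq p q * A = Kpq p q := by
    intro A B hAB
    have h1 : A * (Kpq p q * B * Kpq p q) = 1 := by
      rw [← mul_assoc, ← mul_assoc, hAB, Kpq_mul_self]
    have h2 := congrArg (Kpq p q * ·) (mul_eq_one_comm.1 h1)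
    simp only [mul_one] at h2
    rw [← mul_assoc, ← mul_assoc, ← mul_assoc, Kpq_mul_self, one_mul] at h2
    exact h2
  exact ⟨key _ _, key _ _⟩

lemma inv_mul_mem_SpPQ_iff {a b : SpC p q} : a⁻¹ * b ∈ SpPQ p q ↔
    spVal a * Kpq p q * (spVal a)ᴴ = spVal b * Kpq p q * (spVal b)ᴴ := by
  have h1 : (spVal a)ᴴ * (spVal a⁻¹)ᴴ = 1 := by
    rw [← conjTranspose_mul, spVal_inv_mul, conjTranspose_one]
  have h2 : (spVal a⁻¹)ᴴ * (spVal a)ᴴ = 1 := mul_eq_one_comm.1 h1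
  have h3 : spVal (a⁻¹ * b) * Kpq p q * (spVal (a⁻¹ * b))ᴴ =
      spVal a⁻¹ * (spVal b * Kpq p q * (spVal b)ᴴ) * (spVal a⁻¹)ᴴ := by
    rw [spVal_mul, conjTranspose_mul]
    simp only [mul_assoc]
  rw [mem_SpPQ_iff, h3]
  constructor
  · intro h
    conv_lhs => rw [← h]
    calc _ = (spVal a * spVal a⁻¹) * (spVal b * Kpq p q * (spVal b)ᴴ) *
          ((spVal a⁻¹)ᴴ * (spVal a)ᴴ) := by simp only [mul_assoc]
      _ = _ := by rw [spVal_mul_inv, h2, one_mul, mul_one]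
  · intro h
    rw [← h]
    calc _ = (spVal a⁻¹ * spVal a) * Kpq p q * ((spVal a)ᴴ * (spVal a⁻¹)ᴴ) := by
          simp only [mul_assoc]
      _ = _ := by rw [spVal_inv_mul, h1, one_mul, mul_one]

/-- The orbit map `gH ↦ g K g*` embedding `G/H` in the space of matrices. -/
def orbitMap : SpC p q ⧸ SpPQ p q → Matrix (SpIdx p q) (SpIdx p q) ℂ :=
  Quotient.lift (fun g : SpC p q => spVal g * Kpq p q * (spVal g)ᴴ)
    fun _ _ hab => inv_mul_mem_SpPQ_iff.1 (QuotientGroup.leftRel_apply.1 hab)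

lemma orbitMap_mk (g : SpC p q) :
    orbitMap (g : SpC p q ⧸ SpPQ p q) = spVal g * Kpq p q * (spVal g)ᴴ := rfl

lemma orbitMap_injective : Function.Injective (orbitMap (p := p) (q := q)) := by
  intro x y hxy
  obtain ⟨a, rfl⟩ := QuotientGroup.mk_surjective x
  obtain ⟨b, rfl⟩ := QuotientGroup.mk_surjective y
  exact QuotientGroup.eq.2 (inv_mul_mem_SpPQ_iff.2 hxy)

lemma continuous_orbitMap : Continuous (orbitMap (p := p) (q := q)) := by
  refine continuous_quot_lift _ ?_
  have := continuous_spVal (p := p) (q := q)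
  fun_prop

lemma orbitMap_smul (g : SpC p q) (x : SpC p q ⧸ SpPQ p q) :
    orbitMap (g • x) = spVal g * orbitMap x * (spVal g)ᴴ := by
  obtain ⟨a, rfl⟩ := QuotientGroup.mk_surjective x
  change orbitMap ((g * a : SpC p q) : SpC p q ⧸ SpPQ p q) = _
  rw [orbitMap_mk, orbitMap_mk, spVal_mul, conjTranspose_mul]
  simp only [mul_assoc]

instance : T2Space (SpC p q ⧸ SpPQ p q) :=
  T2Space.of_injective_continuous orbitMap_injective continuous_orbitMap

/-- The orbit of the base point under the maximal compact subgroup. -/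
def compactOrbit (p q : ℕ) : Set (SpC p q ⧸ SpPQ p q) :=
  (fun g : SpC p q => (g : SpC p q ⧸ SpPQ p q)) '' {g | (spVal g)ᴴ * spVal g = 1}

lemma isCompact_compactOrbit : IsCompact (compactOrbit p q) :=
  isCompact_setOf_unitary.image QuotientGroup.continuous_mk

lemma conjTranspose_spVal_mul (g : SpC p q) :
    (spVal g)ᴴ * quaternionicConj p q (spVal g) = 1 :=
  conjTranspose_mul_quaternionicConj.2 g.2

lemma image_compactOrbit :
    orbitMap '' compactOrbit p q = fixedUnitaryOrbit (quaternionicConj p q) (Kpq p q) := by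
  ext X
  constructor
  · rintro ⟨_, ⟨u, hu, rfl⟩, rfl⟩
    refine ⟨spVal u, hu, ?_, rfl⟩
    have hu' : spVal u * (spVal u)ᴴ = 1 := mul_eq_one_comm.1 hu
    calc _ = spVal u * (spVal u)ᴴ * quaternionicConj p q (spVal u) := by rw [hu', one_mul]
      _ = spVal u := by rw [mul_assoc, conjTranspose_spVal_mul, mul_one]
  · rintro ⟨u, hu, hσ, rfl⟩
    have h : uᵀ * OmegaC p q * u = OmegaC p q :=
      conjTranspose_mul_quaternionicConj.1 (by rw [hσ, hu])
    exact ⟨_, ⟨spMk u h, hu, rfl⟩, rfl⟩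

/-- Every continuous field of skew-Hermitian quaternionic matrices on the compact orbit commutes
with the position somewhere. -/
lemma exists_commute_orbitMap {b : SpC p q ⧸ SpPQ p q → Matrix (SpIdx p q) (SpIdx p q) ℂ}
    (hb : Continuous b) (hbV : ∀ x, b x ∈ fixedSkewAdjoint (quaternionicConj p q)) :
    ∃ x ∈ compactOrbit p q, Commute (b x) (orbitMap x) := by
  have : CompactSpace (compactOrbit p q) := isCompact_iff_compactSpace.1 isCompact_compactOrbit
  obtain ⟨x, hx⟩ := exists_commute_of_continuous (C := compactOrbit p q)
    (f := fun x => orbitMap x.1) (σ := quaternionicConj p q) (K := Kpq p q)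
    (continuous_orbitMap.comp continuous_subtype_val)
    (orbitMap_injective.comp Subtype.val_injective)
    (by rw [← image_compactOrbit, Set.image_eq_range])
    Kpq_mem Kpq_mul_self regularDiagonal_mem commute_regularDiagonal_Kpq
    (fun _ _ => regularDiagonal_centralizer) (hb.comp continuous_subtype_val) fun x => hbV x
  exact ⟨x, x.2, hx⟩

end SymplecticTopology

section CliffordKlein

open scoped ComplexOrder

variable {p q : ℕ}

lemma continuous_quaternionicConj : Continuous (quaternionicConj p q) := by
  have h : Continuous fun Z : Matrix (SpIdx p q) (SpIdx p q) ℂ =>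
      OmegaC p q * Z.map (starRingEnd ℂ) * -OmegaC p q :=
    (continuous_const.matrix_mul (continuous_id.matrix_map Complex.continuous_conj)).matrix_mul
      continuous_const
  exact h

lemma smul_sub_quaternionicConj_mem {A : Matrix (SpIdx p q) (SpIdx p q) ℂ} (hA : Aᴴ = A) :
    Complex.I • (A - quaternionicConj p q A) ∈ fixedSkewAdjoint (quaternionicConj p q) := by
  constructor
  · rw [conjTranspose_smul, conjTranspose_sub, ← map_conjTranspose, hA, Complex.star_def,
      Complex.conj_I, neg_smul]
  · rw [quaternionicConj_smul, map_sub, quaternionicConj_quaternionicConj, Complex.conj_I,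
      neg_smul, ← smul_neg, neg_sub]

instance (Γ : Subgroup (SpC p q)) : ContinuousConstSMul Γ (SpC p q ⧸ SpPQ p q) :=
  ⟨fun γ => continuous_const_smul (γ : SpC p q)⟩

/-- If `Γ` acts properly discontinuously and cocompactly on `G/H`, then `Γ` translates every element
of `G` into a fixed bounded set. -/
lemma exists_trace_bound (Γ : Subgroup (SpC p q)) [ProperlyDiscontinuousSMul Γ (SpC p q ⧸ SpPQ p q)]
    [CompactSpace (MulAction.orbitRel.Quotient Γ (SpC p q ⧸ SpPQ p q))] :
    ∃ R : ℝ, ∀ g : SpC p q, ∃ γ : Γ,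
      (spVal (γ.1 * g) * (spVal (γ.1 * g))ᴴ).trace.re ≤ R := by
  obtain ⟨D, hD, hcov⟩ := exists_isCompact_forall_exists_smul_mem Γ (Y := SpC p q ⧸ SpPQ p q)
  let ρ : Γ →* Matrix (SpIdx p q) (SpIdx p q) ℂ :=
    (Units.coeHom _).comp ((SpC p q).subtype.comp Γ.subtype)
  obtain ⟨A, hAc, hApos, hAeq⟩ := exists_equivariant_posDef hD hcov ρ
  have hAeq' : ∀ (γ : Γ) y, A (γ • y) = spVal γ.1 * A y * (spVal γ.1)ᴴ := hAeq
  let S : SpC p q ⧸ SpPQ p q → Matrix (SpIdx p q) (SpIdx p q) ℂ := fun y =>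
    symmetrization (quaternionicConj p q) (A y) (orbitMap y)
  have hXh : ∀ y : SpC p q ⧸ SpPQ p q, (orbitMap y)ᴴ = orbitMap y := by
    intro y
    obtain ⟨a, rfl⟩ := QuotientGroup.mk_surjective y
    rw [orbitMap_mk]
    simp only [conjTranspose_mul, conjTranspose_conjTranspose, Kpq_conjTranspose, mul_assoc]
  have hSpos : ∀ y, (S y).PosDef := fun y => posDef_symmetrization _ (hApos y) (hXh y)
  have hXc := continuous_orbitMap (p := p) (q := q)
  have hSc : Continuous S :=
    hAc.add ((hXc.matrix_mul (continuous_quaternionicConj.comp hAc)).matrix_mul hXc)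
  have hSic : Continuous fun y => (S y)⁻¹ := by
    have h : (fun y => (S y)⁻¹) = fun y => ((S y).det)⁻¹ • (S y).adjugate := by
      ext1 y
      rw [inv_def, Ring.inverse_eq_inv']
    rw [h]
    exact (hSc.matrix_det.inv₀ fun y => (hSpos y).det_pos.ne').smul hSc.matrix_adjugate
  have hφ : Continuous fun y =>
      ((S y).trace + (orbitMap y * (S y)⁻¹ * orbitMap y).trace).re :=
    Complex.continuous_re.comp
      (hSc.matrix_trace.add ((hXc.matrix_mul hSic).matrix_mul hXc).matrix_trace)
  obtain ⟨M, hM⟩ := hD.bddAbove_image hφ.continuousOn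
  refine ⟨M / 2, fun g => ?_⟩
  let A' : SpC p q ⧸ SpPQ p q → Matrix (SpIdx p q) (SpIdx p q) ℂ := fun x =>
    spVal g⁻¹ * A (g • x) * (spVal g⁻¹)ᴴ
  have hA'c : Continuous A' :=
    (continuous_const.matrix_mul (hAc.comp (continuous_const_smul g))).matrix_mul continuous_const
  have hA'pos : ∀ x, (A' x).PosDef := fun x => (hApos _).mul_mul_conjTranspose_same
    (vecMul_injective_of_isUnit (IsUnit.of_mul_eq_one _ (spVal_inv_mul g)))
  have hbc : Continuous fun x => Complex.I • (A' x - quaternionicConj p q (A' x)) :=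
    (hA'c.sub (continuous_quaternionicConj.comp hA'c)).const_smul Complex.I
  obtain ⟨x, hx, hcomm⟩ := exists_commute_orbitMap
    (b := fun x => Complex.I • (A' x - quaternionicConj p q (A' x)))
    hbc fun x => smul_sub_quaternionicConj_mem (hA'pos x).isHermitian
  have hcomm' : Commute (A' x - quaternionicConj p q (A' x)) (orbitMap x) := by
    have h := hcomm.smul_left (-Complex.I)
    rwa [smul_smul, neg_mul, Complex.I_mul_I, neg_neg, one_smul] at h
  have hX2 : orbitMap x * orbitMap x = 1 := mul_self_of_mem_fixedUnitaryOrbit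
    (σ := quaternionicConj p q) Kpq_mul_self (image_compactOrbit ▸ Set.mem_image_of_mem _ hx)
  obtain ⟨γ, hγ⟩ := hcov (g • x)
  refine ⟨γ, ?_⟩
  have hAa : A (γ • g • x) = spVal (γ.1 * g) * A' x * (spVal (γ.1 * g))ᴴ := by
    have h2 : (spVal g⁻¹)ᴴ * (spVal g)ᴴ = 1 := by
      rw [← conjTranspose_mul, spVal_mul_inv, conjTranspose_one]
    rw [hAeq', spVal_mul, conjTranspose_mul]
    calc _ = spVal γ.1 * (spVal g * spVal g⁻¹) * A (g • x) *
          ((spVal g⁻¹)ᴴ * (spVal g)ᴴ) * (spVal γ.1)ᴴ := by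
          rw [spVal_mul_inv, h2, mul_one, mul_one]
      _ = _ := by simp only [A', mul_assoc]
  have hZ : orbitMap (γ • g • x) = spVal (γ.1 * g) * orbitMap x * (spVal (γ.1 * g))ᴴ := by
    rw [← orbitMap_smul, mul_smul]
    rfl
  have hS : S (γ • g • x) = symmetrization (quaternionicConj p q)
      (spVal (γ.1 * g) * A' x * (spVal (γ.1 * g))ᴴ) (orbitMap (γ • g • x)) := by
    rw [← hAa]
  have h1 := two_mul_trace_le (hA'pos x) (hXh x) hX2 hcomm' (conjTranspose_spVal_mul _) hZ hS
  have h2 := hM (Set.mem_image_of_mem _ hγ)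
  linarith

/-- A symplectic lift of a unipotent one-parameter family of `U(p,q)`. -/
lemma exists_mem_SpPQ_entry (i : Fin p) (j : Fin q) (t : ℝ) : ∃ h ∈ SpPQ p q,
    spVal h (Sum.inl (Sum.inl i)) (Sum.inl (Sum.inr j)) = -(t * Complex.I) := by
  let v : Fin p ⊕ Fin q → ℂ := Pi.single (Sum.inl i) 1 + Pi.single (Sum.inr j) 1
  let w : Fin p ⊕ Fin q → ℂ := Pi.single (Sum.inl i) 1 - Pi.single (Sum.inr j) 1
  let c : ℂ := t * Complex.I
  let U : Matrix (Fin p ⊕ Fin q) (Fin p ⊕ Fin q) ℂ := vecMulVec v w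
  have hwv : w ⬝ᵥ v = 0 := by
    simp [v, w]
  have hUU : U * U = 0 := by
    rw [vecMulVec_mul_vecMulVec, hwv]
    simp
  let M := 1 + c • U
  let M' := 1 - c • U
  have hMM : M' * M = 1 := by
    have h : (c • U) * (c • U) = 0 := by rw [smul_mul_smul_comm, hUU, smul_zero]
    rw [sub_mul, one_mul, mul_add, mul_one, h, add_zero, add_sub_cancel_right]
  let k : Matrix (Fin p ⊕ Fin q) (Fin p ⊕ Fin q) ℂ :=
    diagonal (Sum.elim (fun _ => 1) fun _ => -1)
  have hkv : k *ᵥ v = w := by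
    ext (a | a) <;> simp [k, v, w, mulVec_diagonal]
  have hkk : k * k = 1 := by
    rw [diagonal_mul_diagonal, ← diagonal_one]
    congr 1
    ext (a | a) <;> simp
  have hUH : Uᴴ = vecMulVec w v := by
    rw [conjTranspose_vecMulVec]
    congr 1 <;> ext (a | a) <;> simp [v, w, Pi.single_apply, apply_ite]
  have hkU : Uᴴ * k = k * U := by
    have hvk : v ᵥ* k = w := by
      rw [← hkv, ← vecMul_transpose, diagonal_transpose]
    rw [hUH, vecMulVec_mul, mul_vecMulVec, hkv, hvk]
  have hkU' : k * Uᴴ = U * k := by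
    calc k * Uᴴ = k * (Uᴴ * k) * k := by rw [mul_assoc, mul_assoc, hkk, mul_one]
      _ = U * k := by rw [hkU, ← mul_assoc, hkk, one_mul]
  have hc : star c = -c := by simp [c]
  have hMk : Mᴴ * k * M = k := by
    have h : Mᴴ * k = k * M' := by
      rw [conjTranspose_add, conjTranspose_smul, hc, conjTranspose_one, add_mul, mul_sub, one_mul,
        mul_one, smul_mul_assoc, hkU, mul_smul_comm, neg_smul, sub_eq_add_neg]
    rw [h, mul_assoc, hMM, mul_one]
  have hMk' : M' * k * M'ᴴ = k := by
    have h : k * M'ᴴ = M * k := by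
      rw [conjTranspose_sub, conjTranspose_smul, hc, conjTranspose_one, mul_sub, add_mul, one_mul,
        mul_one, mul_smul_comm, hkU', smul_mul_assoc, neg_smul, sub_neg_eq_add]
    rw [mul_assoc, h, ← mul_assoc, hMM, one_mul]
  let A : Matrix (SpIdx p q) (SpIdx p q) ℂ := fromBlocks M 0 0 M'ᵀ
  have hA : Aᵀ * OmegaC p q * A = OmegaC p q := by
    simp only [A, OmegaC, fromBlocks_transpose, fromBlocks_multiply]
    have h : Mᵀ * M'ᵀ = 1 := by rw [← transpose_mul, hMM, transpose_one]
    simp [h, hMM]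
  refine ⟨spMk A hA, ?_, ?_⟩
  · change Aᴴ * Kpq p q * A = Kpq p q
    have hK : Kpq p q = fromBlocks k 0 0 k := (fromBlocks_diagonal _ _).symm
    rw [hK]
    simp only [A, fromBlocks_conjTranspose, fromBlocks_multiply]
    have h : M'ᵀᴴ * k * M'ᵀ = k := by
      have h1 := congrArg transpose hMk'
      rw [transpose_mul, transpose_mul, ← mul_assoc, diagonal_transpose] at h1
      exact h1
    simp [h, hMk]
  · rw [spVal_spMk]
    simp [A, M, U, v, w, c, vecMulVec_apply]

/-- A subgroup of `G` of the form `F B` with `F` finite and `B` bounded is bounded, while `H` is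
not. -/
theorem not_properlyDiscontinuous_and_cocompact (hp : 0 < p) (hq : 0 < q) (Γ : Subgroup (SpC p q))
    [ProperlyDiscontinuousSMul Γ (SpC p q ⧸ SpPQ p q)]
    [CompactSpace (MulAction.orbitRel.Quotient Γ (SpC p q ⧸ SpPQ p q))] : False := by
  obtain ⟨R, hR⟩ := exists_trace_bound Γ
  let B : Set (SpC p q) := {g | (spVal g * (spVal g)ᴴ).trace.re ≤ R}
  have hB : IsCompact B := isCompact_setOf_trace_le R
  let o : SpC p q ⧸ SpPQ p q := (1 : SpC p q)
  have hBo : IsCompact ((fun g : SpC p q => (g : SpC p q ⧸ SpPQ p q)) '' B) :=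
    hB.image QuotientGroup.continuous_mk
  have hF := ProperlyDiscontinuousSMul.finite_disjoint_inter_image (Γ := Γ)
    (isCompact_singleton (x := o)) hBo
  set F : Set Γ := {γ | (((γ • ·) '' {o}) ∩
    ((fun g : SpC p q => (g : SpC p q ⧸ SpPQ p q)) '' B)).Nonempty}
  let e : SpC p q → ℝ := fun g =>
    ‖spVal g (Sum.inl (Sum.inl ⟨0, hp⟩)) (Sum.inl (Sum.inr ⟨0, hq⟩))‖
  have he : Continuous e := (continuous_spVal.matrix_elem _ _).norm
  have hcpt : IsCompact (⋃ γ ∈ F, (fun b : SpC p q => (γ : SpC p q)⁻¹ * b) '' B) :=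
    hF.isCompact_biUnion fun γ _ => hB.image (continuous_const_mul _)
  obtain ⟨M, hM⟩ := hcpt.bddAbove_image he.continuousOn
  obtain ⟨h, hh, hent⟩ := exists_mem_SpPQ_entry (⟨0, hp⟩ : Fin p) (⟨0, hq⟩ : Fin q) (|M| + 1)
  obtain ⟨γ, hγ⟩ := hR h
  have hγF : γ ∈ F := by
    refine ⟨γ • o, ⟨o, rfl, rfl⟩, γ.1 * h, hγ, ?_⟩
    change ((γ.1 * h : SpC p q) : SpC p q ⧸ SpPQ p q) = ((γ.1 * 1 : SpC p q) : SpC p q ⧸ SpPQ p q)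
    rw [mul_one]
    exact (QuotientGroup.mk_mul_of_mem γ.1 hh)
  have hmem : h ∈ ⋃ γ ∈ F, (fun b : SpC p q => (γ : SpC p q)⁻¹ * b) '' B :=
    Set.mem_biUnion hγF ⟨γ.1 * h, hγ, inv_mul_cancel_left _ _⟩
  have hle : e h ≤ M := hM (Set.mem_image_of_mem e hmem)
  have heh : e h = |M| + 1 := by
    simp only [e, hent, norm_neg, norm_mul, Complex.norm_I, mul_one, Complex.norm_real,
      Real.norm_eq_abs]
    exact abs_of_pos (by positivity)
  linarith [le_abs_self M]

end CliffordKlein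

/-- **No compact Clifford–Klein forms for `Sp(2(p+q),ℂ)/Sp(p,q)`.**
There is no discrete subgroup `Γ` of `G = Sp(2(p+q),ℂ)` acting properly discontinuously and
cocompactly on the homogeneous space `G/H`, where `H = Sp(p,q)`. -/
theorem no_compact_CliffordKlein_form_SpC_SpPQ (p q : ℕ) (hp : 0 < p) (hq : 0 < q) :
    ¬ ∃ Γ : Subgroup ↥(SpC p q), DiscreteTopology ↥Γ ∧
      ProperlyDiscontinuousSMul ↥Γ (↥(SpC p q) ⧸ SpPQ p q) ∧
      CompactSpace (MulAction.orbitRel.Quotient ↥Γ (↥(SpC p q) ⧸ SpPQ p q)) := by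
  rintro ⟨Γ, -, _, _⟩
  exact not_properlyDiscontinuous_and_cocompact hp hq Γ
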